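/- arXiv:1502.07769 — 5 statements merged into one kernel-verified Lean document; each statement's English description precedes it below -/
import Mathlib

section
/- The generic poset (the Fraïssé limit of the class of all finite posets, with reflexive order relation) has universal homogeneous polymorphisms of every arity n ∈ ℕ∖{0}. -/
set_option autoImplicit false

/-! ## Relational signatures and structures -/

structure RelSig where
  symbols : Type
  arity : symbols → ℕ

structure RelStr (σ : RelSig) where
  carrier : Type
  rel : ∀ s : σ.symbols, Set (Fin (σ.arity s) → carrier)

namespace RelStr

variable {σ : RelSig}

/-- Homomorphisms of relational structures. -/
def IsHom (A B : RelStr σ) (h : A.carrier → B.carrier) : Prop :=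
  ∀ (s : σ.symbols) (t : Fin (σ.arity s) → A.carrier),
    t ∈ A.rel s → (fun j => h (t j)) ∈ B.rel s

/-- Embeddings of relational structures. -/
def IsEmb (A B : RelStr σ) (h : A.carrier → B.carrier) : Prop :=
  Function.Injective h ∧
    ∀ (s : σ.symbols) (t : Fin (σ.arity s) → A.carrier),
      t ∈ A.rel s ↔ (fun j => h (t j)) ∈ B.rel s

/-- Automorphisms: surjective self-embeddings. -/
def IsAut (A : RelStr σ) (h : A.carrier → A.carrier) : Prop :=
  Function.Surjective h ∧ IsEmb A A h

/-- The n-th direct power of a relational structure. -/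
def pow (A : RelStr σ) (n : ℕ) : RelStr σ where
  carrier := Fin n → A.carrier
  rel s := {t | ∀ i : Fin n, (fun j => t j i) ∈ A.rel s}

/-- The direct product of two relational structures. -/
def prod (A B : RelStr σ) : RelStr σ where
  carrier := A.carrier × B.carrier
  rel s := {t | (fun j => (t j).1) ∈ A.rel s ∧ (fun j => (t j).2) ∈ B.rel s}

/-- `A.inAge B` : `B` belongs to the age of `A`, i.e. `B` is finite and embeddable into `A`. -/
def inAge (A B : RelStr σ) : Prop :=
  Finite B.carrier ∧ ∃ h : B.carrier → A.carrier, IsEmb B A h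

/-- `Younger A U` : the age of `A` is contained in the age of `U`. -/
def Younger (A U : RelStr σ) : Prop :=
  ∀ B : RelStr σ, inAge A B → inAge U B

/-- Homogeneity: any two embeddings of a member of the age differ by an automorphism. -/
def IsHomogeneous (U : RelStr σ) : Prop :=
  ∀ B : RelStr σ, inAge U B →
    ∀ ι₁ ι₂ : B.carrier → U.carrier, IsEmb B U ι₁ → IsEmb B U ι₂ →
      ∃ h : U.carrier → U.carrier, IsAut U h ∧ ∀ b, h (ι₁ b) = ι₂ b

/-- ω-categoricity of a countable structure, rendered via the
Engeler–Ryll-Nardzewski–Svenonius theorem: the automorphism group is oligomorphic,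
i.e. has finitely many orbits on `n`-tuples for every `n`. -/
def IsOligomorphic (U : RelStr σ) : Prop :=
  ∀ n : ℕ, ∃ (k : ℕ) (reps : Fin k → (Fin n → U.carrier)),
    ∀ t : Fin n → U.carrier, ∃ (j : Fin k) (h : U.carrier → U.carrier),
      IsAut U h ∧ ∀ i, h (reps j i) = t i

/-- The automorphism group acts transitively on the carrier. -/
def AutTransitive (U : RelStr σ) : Prop :=
  ∀ x y : U.carrier, ∃ h : U.carrier → U.carrier, IsAut U h ∧ h x = y

/-- `D` (with embeddings `g₁, g₂`) is the amalgamated free sum of `B₁` and `B₂`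
over `A` (with embeddings `f₁, f₂`): the carriers are glued exactly along `A`, and
every relation of `D` comes from `B₁` or from `B₂`. -/
def IsFreeAmalgam (A B₁ B₂ D : RelStr σ)
    (f₁ : A.carrier → B₁.carrier) (f₂ : A.carrier → B₂.carrier)
    (g₁ : B₁.carrier → D.carrier) (g₂ : B₂.carrier → D.carrier) : Prop :=
  IsEmb B₁ D g₁ ∧ IsEmb B₂ D g₂ ∧ (∀ a, g₁ (f₁ a) = g₂ (f₂ a)) ∧
    (∀ d : D.carrier, (∃ b, g₁ b = d) ∨ (∃ b, g₂ b = d)) ∧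
    (∀ b₁ b₂, g₁ b₁ = g₂ b₂ → ∃ a, f₁ a = b₁ ∧ f₂ a = b₂) ∧
    ∀ (s : σ.symbols) (t : Fin (σ.arity s) → D.carrier), t ∈ D.rel s →
      (∃ t' ∈ B₁.rel s, ∀ j, g₁ (t' j) = t j) ∨ (∃ t' ∈ B₂.rel s, ∀ j, g₂ (t' j) = t j)

/-- The age of `U` has the free amalgamation property. -/
def AgeFAP (U : RelStr σ) : Prop :=
  ∀ A B₁ B₂ : RelStr σ, inAge U A → inAge U B₁ → inAge U B₂ →
    ∀ (f₁ : A.carrier → B₁.carrier) (f₂ : A.carrier → B₂.carrier),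
      IsEmb A B₁ f₁ → IsEmb A B₂ f₂ →
      ∃ (D : RelStr σ) (g₁ : B₁.carrier → D.carrier) (g₂ : B₂.carrier → D.carrier),
        inAge U D ∧ IsFreeAmalgam A B₁ B₂ D f₁ f₂ g₁ g₂

/-- The age of `U` is closed with respect to finite products. -/
def AgeClosedUnderProducts (U : RelStr σ) : Prop :=
  ∀ A B : RelStr σ, inAge U A → inAge U B → inAge U (A.prod B)

/-- The age of `U` has the homo-amalgamation property (HAP). -/
def AgeHAP (U : RelStr σ) : Prop :=
  ∀ A B C : RelStr σ, inAge U A → inAge U B → inAge U C →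
    ∀ (f : A.carrier → B.carrier) (g : A.carrier → C.carrier),
      IsHom A B f → IsEmb A C g →
      ∃ (D : RelStr σ) (f' : C.carrier → D.carrier) (g' : B.carrier → D.carrier),
        inAge U D ∧ IsHom C D f' ∧ IsEmb B D g' ∧ ∀ a, f' (g a) = g' (f a)

end RelStr

open RelStr

/-! ## Primitive positive formulas -/

/-- Primitive positive formulas with `n` free variables. -/
inductive PP (σ : RelSig) : ℕ → Type
  | eq : ∀ {n : ℕ}, Fin n → Fin n → PP σ n
  | rel : ∀ {n : ℕ} (s : σ.symbols), (Fin (σ.arity s) → Fin n) → PP σ n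
  | and : ∀ {n : ℕ}, PP σ n → PP σ n → PP σ n
  | ex : ∀ {n : ℕ}, PP σ (n + 1) → PP σ n

/-- Satisfaction of a primitive positive formula. -/
def PP.Sat {σ : RelSig} (U : RelStr σ) : ∀ {n : ℕ}, PP σ n → (Fin n → U.carrier) → Prop
  | _, .eq i j, t => t i = t j
  | _, .rel s v, t => (fun k => t (v k)) ∈ U.rel s
  | _, .and φ ψ, t => PP.Sat U φ t ∧ PP.Sat U ψ t
  | _, .ex φ, t => ∃ a : U.carrier, PP.Sat U φ (Fin.snoc t a)

/-- Quantifier-free primitive positive formulas. -/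
def PP.QFree {σ : RelSig} : ∀ {n : ℕ}, PP σ n → Prop
  | _, .eq _ _ => True
  | _, .rel _ _ => True
  | _, .and φ ψ => PP.QFree φ ∧ PP.QFree ψ
  | _, .ex _ => False

/-- `U` has quantifier elimination for primitive positive formulas. -/
def HasPPQE {σ : RelSig} (U : RelStr σ) : Prop :=
  ∀ (n : ℕ) (φ : PP σ n), ∃ ψ : PP σ n, PP.QFree ψ ∧
    ∀ t : Fin n → U.carrier, PP.Sat U φ t ↔ PP.Sat U ψ t

/-! ## Polymorphisms -/

/-- An `n`-ary polymorphism of `U`: a homomorphism `Uⁿ → U`. -/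
def IsPolymorphism {σ : RelSig} (U : RelStr σ) (n : ℕ)
    (u : (Fin n → U.carrier) → U.carrier) : Prop :=
  IsHom (U.pow n) U u

/-- Universal `n`-ary polymorphism. -/
def IsUniversalPolymorphism {σ : RelSig} (U : RelStr σ) (n : ℕ)
    (u : (Fin n → U.carrier) → U.carrier) : Prop :=
  IsPolymorphism U n u ∧
    ∀ A : RelStr σ, Countable A.carrier → Younger A U →
      ∀ f : (Fin n → A.carrier) → U.carrier, IsHom (A.pow n) U f →
        ∃ ι : A.carrier → U.carrier, IsEmb A U ι ∧
          ∀ t : Fin n → A.carrier, f t = u (fun i => ι (t i))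

/-- Homogeneous `n`-ary polymorphism. -/
def IsHomogeneousPolymorphism {σ : RelSig} (U : RelStr σ) (n : ℕ)
    (u : (Fin n → U.carrier) → U.carrier) : Prop :=
  IsPolymorphism U n u ∧
    ∀ A : RelStr σ, inAge U A →
      ∀ f : (Fin n → A.carrier) → U.carrier, IsHom (A.pow n) U f →
        ∀ ι₁ ι₂ : A.carrier → U.carrier, IsEmb A U ι₁ → IsEmb A U ι₂ →
          (∀ t : Fin n → A.carrier, u (fun i => ι₁ (t i)) = f t) →
          (∀ t : Fin n → A.carrier, u (fun i => ι₂ (t i)) = f t) →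
          ∃ h : U.carrier → U.carrier, IsAut U h ∧ (∀ a, h (ι₁ a) = ι₂ a) ∧
            ∀ t : Fin n → U.carrier, u (fun i => h (t i)) = u t

/-! ## Clones of finitary operations

Operations of arity `n + 1` are indexed by `n : ℕ`, so that all arities are `≥ 1`. -/

structure Clone (U : Type) where
  ops : ∀ n : ℕ, Set ((Fin (n + 1) → U) → U)
  proj_mem : ∀ (n : ℕ) (i : Fin (n + 1)), (fun x => x i) ∈ ops n
  comp_mem : ∀ {n m : ℕ} (f : (Fin (n + 1) → U) → U) (g : Fin (n + 1) → (Fin (m + 1) → U) → U),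
      f ∈ ops n → (∀ i, g i ∈ ops m) → (fun x => f fun i => g i x) ∈ ops m

/-- The underlying set of a clone: the disjoint sum of its arity fibers. -/
abbrev Clone.Elem {U : Type} (C : Clone U) : Type := Σ n : ℕ, ↥(C.ops n)

/-- The polymorphism clone of a relational structure. -/
def polClone {σ : RelSig} (U : RelStr σ) : Clone U.carrier where
  ops n := {f | IsPolymorphism U (n + 1) f}
  proj_mem n i := fun s t ht => ht i
  comp_mem f g hf hg := fun s t ht => hf s (fun j i => g i (t j)) (fun i => hg i s t ht)

/-- The topology of pointwise convergence (the carrier being discrete) on the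
space of `n+1`-ary operations on `U`. -/
def fnTop (U : Type) (n : ℕ) : TopologicalSpace ((Fin (n + 1) → U) → U) :=
  letI : TopologicalSpace U := ⊥
  inferInstance

/-- The topology of pointwise convergence on an arity fiber of a clone. -/
def opsTop {U : Type} (C : Clone U) (n : ℕ) : TopologicalSpace ↥(C.ops n) :=
  letI : TopologicalSpace U := ⊥
  inferInstance

/-- The canonical topology on a clone: the sum over all arities of the topologies
of pointwise convergence. -/
def cloneTop {U : Type} (C : Clone U) : TopologicalSpace C.Elem :=
  letI : TopologicalSpace U := ⊥
  inferInstance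

/-- Clone homomorphisms: arity preserving maps preserving projections and composition. -/
structure CloneHom {U V : Type} (C : Clone U) (D : Clone V) where
  app : ∀ n : ℕ, ↥(C.ops n) → ↥(D.ops n)
  map_proj : ∀ (n : ℕ) (i : Fin (n + 1)),
    (app n ⟨fun x => x i, C.proj_mem n i⟩).val = fun x => x i
  map_comp : ∀ (n m : ℕ) (f : ↥(C.ops n)) (g : Fin (n + 1) → ↥(C.ops m)),
    (app m ⟨fun x => f.val fun i => (g i).val x,
        C.comp_mem f.val (fun i => (g i).val) f.property (fun i => (g i).property)⟩).val
      = fun x => (app n f).val fun i => (app m (g i)).val x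

/-- The action of a clone homomorphism on the underlying sets. -/
def CloneHom.elemMap {U V : Type} {C : Clone U} {D : Clone V} (h : CloneHom C D) :
    C.Elem → D.Elem :=
  fun p => ⟨p.1, h.app p.1 p.2⟩

/-- Application of a unary operation (in the `Fin 1` encoding) to a point. -/
def ap1 {U : Type} (φ : (Fin 1 → U) → U) (u : U) : U := φ (fun _ => u)

/-- The group of units of the unary part of a clone. -/
def cloneUnits {U : Type} (C : Clone U) : Set ((Fin 1 → U) → U) :=
  {φ | φ ∈ C.ops 0 ∧ ∃ ψ ∈ C.ops 0, (∀ u, ap1 φ (ap1 ψ u) = u) ∧ ∀ u, ap1 ψ (ap1 φ u) = u}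

/-- The closure of the group of units inside the unary part of a clone. -/
def unitClosure {U : Type} (C : Clone U) : Set ((Fin 1 → U) → U) :=
  C.ops 0 ∩ @closure _ (fnTop U 0) (cloneUnits C)

/-- Cauchy sequences of functions with respect to the complete ultrametric of
pointwise convergence (discrete codomain): at every argument, the sequence of
values is eventually constant. -/
def PtwCauchy {α U : Type} (g : ℕ → α → U) : Prop :=
  ∀ x : α, ∃ N : ℕ, ∀ m, N ≤ m → ∀ m', N ≤ m' → g m x = g m' x

/-- Pointwise convergence of a sequence of functions (discrete codomain). -/
def PtwConv {α β : Type} (g : ℕ → α → β) (f : α → β) : Prop :=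
  ∀ x : α, ∃ N : ℕ, ∀ j, N ≤ j → g j x = f x

/-- A strong gate covering of a clone. -/
def StrongGateCovering {U : Type} (C : Clone U) : Prop :=
  ∃ (𝒰 : Set (Set C.Elem)) (F : ∀ V ∈ 𝒰, C.Elem),
    (∀ V ∈ 𝒰, @IsOpen _ (cloneTop C) V) ∧
    (∀ p : C.Elem, ∃ V ∈ 𝒰, p ∈ V) ∧
    (∀ V (hV : V ∈ 𝒰), F V hV ∈ V) ∧
    ∀ V (hV : V ∈ 𝒰) (k : ℕ) (g : ℕ → ↥(C.ops k)),
      (∀ j : ℕ, (⟨k, g j⟩ : C.Elem) ∈ V) →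
      PtwCauchy (fun j => (g j).val) →
      ∃ fV : ↥(C.ops k), F V hV = ⟨k, fV⟩ ∧
        ∃ (κ : ℕ → (Fin 1 → U) → U) (ι : Fin (k + 1) → ℕ → (Fin 1 → U) → U),
          (∀ j, κ j ∈ unitClosure C) ∧ (∀ i j, ι i j ∈ unitClosure C) ∧
          PtwCauchy κ ∧ (∀ i, PtwCauchy (ι i)) ∧
          ∀ (j : ℕ) (x : Fin (k + 1) → U),
            (g j).val x = ap1 (κ j) (fV.val fun i => ap1 (ι i j) (x i))

/-- A closed (sub)clone of the clone of all operations. -/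
def IsClosedClone {U : Type} (C : Clone U) : Prop :=
  ∀ n : ℕ, @IsClosed _ (fnTop U n) (C.ops n)

/-! ## Posets as relational structures -/

/-- The signature with a single binary relation symbol. -/
def sigOrd : RelSig := ⟨Unit, fun _ => 2⟩

/-- A (reflexive) partial order viewed as a relational structure. -/
def ordStruc (P : Type) [PartialOrder P] : RelStr sigOrd where
  carrier := P
  rel _ := {t : Fin 2 → P | t 0 ≤ t 1}

/-! ## The amalgamation extension property AEPⁿ and the homo-amalgamation property HAPⁿ -/

/-- A class `𝒞` of relational structures has the AEPⁿ. -/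
def HasAEPn {σ : RelSig} (𝒞 : RelStr σ → Prop) (n : ℕ) : Prop :=
  ∀ A B₁ B₂ T : RelStr σ, 𝒞 A → 𝒞 B₁ → 𝒞 B₂ → 𝒞 T →
    ∀ (f₁ : A.carrier → B₁.carrier) (f₂ : A.carrier → B₂.carrier),
      RelStr.IsEmb A B₁ f₁ → RelStr.IsEmb A B₂ f₂ →
      ∀ (h₁ : (Fin n → B₁.carrier) → T.carrier) (h₂ : (Fin n → B₂.carrier) → T.carrier),
        RelStr.IsHom (B₁.pow n) T h₁ → RelStr.IsHom (B₂.pow n) T h₂ →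
        (∀ t : Fin n → A.carrier, h₁ (fun i => f₁ (t i)) = h₂ (fun i => f₂ (t i))) →
        ∃ (C T' : RelStr σ) (g₁ : B₁.carrier → C.carrier) (g₂ : B₂.carrier → C.carrier)
            (k : T.carrier → T'.carrier) (h : (Fin n → C.carrier) → T'.carrier),
          𝒞 C ∧ 𝒞 T' ∧ RelStr.IsEmb B₁ C g₁ ∧ RelStr.IsEmb B₂ C g₂ ∧
            (∀ a, g₁ (f₁ a) = g₂ (f₂ a)) ∧ RelStr.IsEmb T T' k ∧
            RelStr.IsHom (C.pow n) T' h ∧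
            (∀ t : Fin n → B₁.carrier, h (fun i => g₁ (t i)) = k (h₁ t)) ∧
            (∀ t : Fin n → B₂.carrier, h (fun i => g₂ (t i)) = k (h₂ t))

/-- A class `𝒞` of relational structures has the HAPⁿ. -/
def HasHAPn {σ : RelSig} (𝒞 : RelStr σ → Prop) (n : ℕ) : Prop :=
  ∀ A B T₁ : RelStr σ, 𝒞 A → 𝒞 B → 𝒞 T₁ →
    ∀ (g : A.carrier → B.carrier) (a : (Fin n → A.carrier) → T₁.carrier),
      RelStr.IsEmb A B g → RelStr.IsHom (A.pow n) T₁ a →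
      ∃ (T₂ : RelStr σ) (h : T₁.carrier → T₂.carrier) (b : (Fin n → B.carrier) → T₂.carrier),
        𝒞 T₂ ∧ RelStr.IsEmb T₁ T₂ h ∧ RelStr.IsHom (B.pow n) T₂ b ∧
          ∀ t : Fin n → A.carrier, b (fun i => g (t i)) = h (a t)
/-- A countable family of dense sets is met by some increasing sequence. -/
lemma exists_monotone_seq_meeting {C ι : Type} [Preorder C] [Countable ι] (c₀ : C)
    (D : ι → Set C) (hD : ∀ i c, ∃ c' ∈ D i, c ≤ c') :
    ∃ s : ℕ → C, Monotone s ∧ c₀ ≤ s 0 ∧ ∀ i, ∃ k, s k ∈ D i := by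
  have := Encodable.ofCountable ι
  let 𝒟 : ι → Order.Cofinal C := fun i => ⟨D i, fun c => hD i c⟩
  refine ⟨Order.sequenceOfCofinals c₀ 𝒟, Order.sequenceOfCofinals.monotone c₀ 𝒟, le_rfl,
    fun i => ⟨_, Order.sequenceOfCofinals.encode_mem c₀ 𝒟 i⟩⟩

/-- The one-point extension property: every consistent quantifier-free type of a new point over a
finite set, given by its lower and its upper part, is realized. -/
def HasOnePointExt (P : Type) [PartialOrder P] : Prop :=
  ∀ (S : Finset P) (D V : P → Prop),
    (∀ s ∈ S, ∀ s' ∈ S, s ≤ s' → D s' → D s) → (∀ s ∈ S, ∀ s' ∈ S, s ≤ s' → V s → V s') →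
    (∀ s ∈ S, ∀ s' ∈ S, D s → V s' → s ≤ s') → (∀ s ∈ S, D s → ¬ V s) →
    ∃ q : P, ∀ s ∈ S, (s ≤ q ↔ D s) ∧ (q ≤ s ↔ V s)

/-- The order on `S` with a new point `none` adjoined, with lower part `D` and upper part `V`. -/
def optionLE {S : Type} [PartialOrder S] (D V : S → Prop) : Option S → Option S → Prop
  | some a, some b => a ≤ b
  | some a, none => D a
  | none, some b => V b
  | none, none => True

abbrev optionPartialOrder {S : Type} [PartialOrder S] (D V : S → Prop)
    (hD : ∀ s s', s ≤ s' → D s' → D s) (hV : ∀ s s', s ≤ s' → V s → V s')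
    (hDV : ∀ s s', D s → V s' → s ≤ s') (hdisj : ∀ s, D s → ¬ V s) :
    PartialOrder (Option S) where
  le := optionLE D V
  lt x y := optionLE D V x y ∧ ¬ optionLE D V y x
  lt_iff_le_not_ge _ _ := Iff.rfl
  le_refl x := by cases x <;> simp [optionLE]
  le_trans
    | none, _, none, _, _ => trivial
    | none, none, some _, _, h => h
    | none, some _, some _, h, h' => hV _ _ h' h
    | some _, none, none, h, _ => h
    | some _, some _, none, h, h' => hD _ _ h h'
    | some _, none, some _, h, h' => hDV _ _ h h'
    | some _, some _, some _, h, h' => le_trans (α := S) h h'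
  le_antisymm
    | none, none, _, _ => rfl
    | none, some _, h, h' => (hdisj _ h' h).elim
    | some _, none, h, h' => (hdisj _ h h').elim
    | some _, some _, h, h' => congrArg some (le_antisymm (α := S) h h')

lemma isEmb_ordStruc {Q P : Type} [PartialOrder Q] [PartialOrder P] {h : Q → P}
    (hh : ∀ a b, h a ≤ h b ↔ a ≤ b) : RelStr.IsEmb (ordStruc Q) (ordStruc P) h :=
  ⟨fun (a b : Q) (hab : h a = h b) => le_antisymm (α := Q) ((hh a b).1 hab.le) ((hh b a).1 hab.ge),
    fun _ t => (hh (t (0 : Fin 2)) (t (1 : Fin 2))).symm⟩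

lemma hasOnePointExt_of_isHomogeneous (P : Type) [PartialOrder P]
    (hhom : RelStr.IsHomogeneous (ordStruc P))
    (hage : ∀ (Q : Type) [PartialOrder Q] [Finite Q],
      ∃ ι : Q → P, ∀ a b : Q, ι a ≤ ι b ↔ a ≤ b) : HasOnePointExt P := by
  intro S D V hD hV hDV hdisj
  let inst : PartialOrder (Option S) := optionPartialOrder (fun s : S => D s) (fun s => V s)
    (fun s s' => hD s s.2 s' s'.2) (fun s s' => hV s s.2 s' s'.2)
    (fun s s' => hDV s s.2 s' s'.2) (fun s => hdisj s s.2)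
  obtain ⟨ι, hι⟩ := hage (Option S)
  have hval : RelStr.IsEmb (ordStruc S) (ordStruc P) Subtype.val :=
    isEmb_ordStruc fun _ _ => Iff.rfl
  have hsome : RelStr.IsEmb (ordStruc S) (ordStruc P) (fun s => ι (some s)) :=
    isEmb_ordStruc fun a b => hι (some a) (some b)
  obtain ⟨(h : P → P), ⟨-, -, hh⟩, hext⟩ :=
    hhom (ordStruc S) ⟨inferInstanceAs (Finite S), _, hval⟩ _ _ hsome hval
  have hle : ∀ x y : P, x ≤ y ↔ h x ≤ h y := fun x y => hh () ![x, y]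
  refine ⟨h (ι none), fun s hs => ?_⟩
  have e : h (ι (some ⟨s, hs⟩)) = s := hext ⟨s, hs⟩
  constructor
  · conv_lhs => rw [← e]
    rw [← hle, hι]
    exact Iff.rfl
  · conv_lhs => rw [← e]
    rw [← hle, hι]
    exact Iff.rfl

namespace HasOnePointExt

variable {P : Type} [PartialOrder P]

lemma exists_between (hP : HasOnePointExt P) {L V : Set P} (hL : L.Finite) (hV : V.Finite)
    (hLV : ∀ l ∈ L, ∀ v ∈ V, l ≤ v) : ∃ q, (∀ l ∈ L, l ≤ q) ∧ ∀ v ∈ V, q ≤ v := by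
  by_cases hm : ∃ s, (∃ l ∈ L, s ≤ l) ∧ ∃ v ∈ V, v ≤ s
  · obtain ⟨s, ⟨l, hl, hsl⟩, v, hv, hvs⟩ := hm
    exact ⟨s, fun l' hl' => (hLV l' hl' v hv).trans hvs, fun v' hv' => hsl.trans (hLV l hl v' hv')⟩
  · push Not at hm
    obtain ⟨q, hq⟩ := hP (hL.union hV).toFinset (fun s => ∃ l ∈ L, s ≤ l) (fun s => ∃ v ∈ V, v ≤ s)
      (fun s _ s' _ h ⟨l, hl, h'⟩ => ⟨l, hl, h.trans h'⟩)
      (fun s _ s' _ h ⟨v, hv, h'⟩ => ⟨v, hv, h'.trans h⟩)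
      (fun s _ s' _ ⟨l, hl, h⟩ ⟨v, hv, h'⟩ => h.trans ((hLV l hl v hv).trans h'))
      (fun s _ hl ⟨v, hv, h'⟩ => hm s hl v hv h')
    exact ⟨q, fun l hl => (hq l (by simp [hl])).1.2 ⟨l, hl, le_rfl⟩,
      fun v hv => (hq v (by simp [hv])).2.2 ⟨v, hv, le_rfl⟩⟩

lemma exists_extend_monotoneOn (hP : HasOnePointExt P) {X : Type} [Preorder X] {T T' : Set X}
    (hT : T.Finite) (hT' : T'.Finite) (F : X → P) (hF : MonotoneOn F T) :
    ∃ F' : X → P, Set.EqOn F' F T ∧ MonotoneOn F' (T' ∪ T) := by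
  classical
  induction T', hT' using Set.Finite.induction_on with
  | empty => exact ⟨F, fun _ _ => rfl, by simpa using hF⟩
  | @insert x T' _ hT' ih =>
    obtain ⟨F', hEq, hmono⟩ := ih
    by_cases hx : x ∈ T' ∪ T
    · exact ⟨F', hEq, by rwa [Set.insert_union, Set.insert_eq_of_mem hx]⟩
    have hfin : (T' ∪ T).Finite := hT'.union hT
    obtain ⟨q, hql, hqv⟩ := hP.exists_between
      (L := F' '' {y ∈ T' ∪ T | y ≤ x}) (V := F' '' {y ∈ T' ∪ T | x ≤ y})
      ((hfin.subset (Set.sep_subset _ _)).image _) ((hfin.subset (Set.sep_subset _ _)).image _)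
      (by
        rintro _ ⟨y, ⟨hy, hyx⟩, rfl⟩ _ ⟨z, ⟨hz, hxz⟩, rfl⟩
        exact hmono hy hz (hyx.trans hxz))
    have hne : ∀ y ∈ T' ∪ T, y ≠ x := fun y hy e => hx (e ▸ hy)
    refine ⟨Function.update F' x q, fun y hy => ?_, ?_⟩
    · rw [Function.update_of_ne (hne y (Or.inr hy)), hEq hy]
    · rw [Set.insert_union]
      rintro y (rfl | hy) z (rfl | hz) hyz
      · rfl
      · rw [Function.update_self, Function.update_of_ne (hne z hz)]
        exact hqv _ ⟨z, ⟨hz, hyz⟩, rfl⟩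
      · rw [Function.update_self, Function.update_of_ne (hne y hy)]
        exact hql _ ⟨y, ⟨hy, hyz⟩, rfl⟩
      · rw [Function.update_of_ne (hne y hy), Function.update_of_ne (hne z hz)]
        exact hmono hy hz hyz

/-- The type of `q` over `S` is realized over `S'` freely: by a point which is comparable to
elements of `S'` only through elements of `S`. -/
lemma exists_free_realization (hP : HasOnePointExt P) {S : Finset P} (S' : Finset P) {q : P}
    (hq : q ∉ S) : ∃ p, p ∉ S' ∧ ∀ s ∈ S', (s ≤ p ↔ ∃ a ∈ S, s ≤ a ∧ a ≤ q) ∧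
      (p ≤ s ↔ ∃ a ∈ S, q ≤ a ∧ a ≤ s) := by
  have hdisj : ∀ s, (∃ a ∈ S, s ≤ a ∧ a ≤ q) → ¬ ∃ a ∈ S, q ≤ a ∧ a ≤ s := by
    rintro s ⟨a, ha, hsa, haq⟩ ⟨b, hb, hqb, hbs⟩
    exact hq (le_antisymm haq (hqb.trans (hbs.trans hsa)) ▸ ha)
  obtain ⟨p, hp⟩ := hP S' (fun s => ∃ a ∈ S, s ≤ a ∧ a ≤ q) (fun s => ∃ a ∈ S, q ≤ a ∧ a ≤ s)
    (fun s _ s' _ h ⟨a, ha, h₁, h₂⟩ => ⟨a, ha, h.trans h₁, h₂⟩)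
    (fun s _ s' _ h ⟨a, ha, h₁, h₂⟩ => ⟨a, ha, h₁, h₂.trans h⟩)
    (fun s _ s' _ ⟨a, _, h₁, h₂⟩ ⟨b, _, h₃, h₄⟩ => h₁.trans (h₂.trans (h₃.trans h₄)))
    (fun s _ => hdisj s)
  exact ⟨p, fun hmem => hdisj p ((hp p hmem).1.1 le_rfl) ((hp p hmem).2.1 le_rfl), hp⟩

end HasOnePointExt

/-- A finite approximation to an `n`-ary polymorphism: an operation that is monotone on the
tuples with entries in a finite set. -/
structure PolApprox (n : ℕ) (P : Type) [PartialOrder P] where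
  support : Finset P
  op : (Fin n → P) → P
  mono : MonotoneOn op {t | ∀ i, t i ∈ support}

namespace PolApprox

variable {n : ℕ} {P : Type} [PartialOrder P]

instance : Preorder (PolApprox n P) where
  le c d := c.support ⊆ d.support ∧ ∀ t : Fin n → P, (∀ i, t i ∈ c.support) → d.op t = c.op t
  le_refl _ := ⟨Finset.Subset.refl _, fun _ _ => rfl⟩
  le_trans _ _ _ h h' :=
    ⟨h.1.trans h'.1, fun t ht => (h'.2 t fun i => h.1 (ht i)).trans (h.2 t ht)⟩

omit [PartialOrder P] in
lemma finite_tuples (S : Finset P) : {t : Fin n → P | ∀ i, t i ∈ S}.Finite :=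
  Set.Finite.pi' fun _ => S.finite_toSet

/-- A monotone operation on some tuples over `S` extends to an approximation supported on `S`. -/
lemma exists_extend (hP : HasOnePointExt P) (S : Finset P) {T : Set (Fin n → P)} (hT : T.Finite)
    (F : (Fin n → P) → P) (hF : MonotoneOn F T) :
    ∃ d : PolApprox n P, d.support = S ∧ Set.EqOn d.op F T := by
  obtain ⟨F', hEq, hmono⟩ := hP.exists_extend_monotoneOn hT (finite_tuples S) F hF
  exact ⟨⟨S, F', hmono.mono Set.subset_union_left⟩, rfl, hEq⟩

lemma exists_le_support (hP : HasOnePointExt P) (c : PolApprox n P) (S : Finset P) :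
    ∃ d, c ≤ d ∧ S ⊆ d.support := by
  classical
  obtain ⟨d, hd, hEq⟩ := exists_extend hP (c.support ∪ S) (finite_tuples c.support) c.op c.mono
  exact ⟨d, ⟨hd ▸ Finset.subset_union_left, hEq⟩, hd ▸ Finset.subset_union_right⟩

/-- The point `p` realizes the type of `q` over `S`, and `u` takes on the tuples over
`S ∪ {p}` the values that `g` prescribes on the corresponding tuples over `S ∪ {q}`. -/
def Realizes (u : (Fin n → P) → P) (S : Finset P) (q : P)
    (g : (Fin n → ↥(insert q (S : Set P))) → P) (p : P) : Prop :=
  (∀ s ∈ S, (s ≤ p ↔ s ≤ q) ∧ (p ≤ s ↔ q ≤ s)) ∧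
    ∀ (t : Fin n → ↥(insert q (S : Set P))) (t' : Fin n → P),
      (∀ i, ((t i : P) = q ∧ t' i = p) ∨ ((t i : P) ∈ S ∧ t' i = t i)) → u t' = g t

lemma exists_realizes (hP : HasOnePointExt P) (c : PolApprox n P) {S : Finset P}
    (hS : S ⊆ c.support) {q : P} (hq : q ∉ S) {g : (Fin n → ↥(insert q (S : Set P))) → P}
    (hg : Monotone g)
    (hgc : ∀ t : Fin n → S, g (fun i => ⟨t i, Or.inr (t i).2⟩) = c.op fun i => t i) :
    ∃ d, c ≤ d ∧ ∃ p ∈ d.support, Realizes d.op S q g p := by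
  classical
  obtain ⟨p, hpc, hp⟩ := hP.exists_free_realization c.support hq
  have hpS : p ∉ S := fun h => hpc (hS h)
  have hpq : ∀ s ∈ S, (s ≤ p ↔ s ≤ q) ∧ (p ≤ s ↔ q ≤ s) := fun s hs =>
    ⟨(hp s (hS hs)).1.trans ⟨fun ⟨a, _, h, h'⟩ => h.trans h', fun h => ⟨s, hs, le_rfl, h⟩⟩,
      (hp s (hS hs)).2.trans ⟨fun ⟨a, _, h, h'⟩ => h.trans h', fun h => ⟨s, hs, h, le_rfl⟩⟩⟩
  let τ : P → ↥(insert q (S : Set P)) := fun x =>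
    if h : x ∈ S then ⟨x, Or.inr h⟩ else ⟨q, Or.inl rfl⟩
  have τS : ∀ (x) (h : x ∈ S), τ x = ⟨x, Or.inr h⟩ := fun x h => dif_pos h
  have τp : τ p = ⟨q, Or.inl rfl⟩ := dif_neg hpS
  have τmono : ∀ x y, (x = p ∨ x ∈ S) → (y = p ∨ y ∈ S) → x ≤ y → τ x ≤ τ y := by
    rintro x y (rfl | hx) (rfl | hy) hxy
    · rfl
    · rw [τp, τS y hy]; exact (hpq y hy).2.1 hxy
    · rw [τp, τS x hx]; exact (hpq x hx).1.1 hxy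
    · rw [τS x hx, τS y hy]; exact hxy
  have hgτ : ∀ a : Fin n → P, (∀ i, a i ∈ S) → g (fun i => τ (a i)) = c.op a := by
    intro a ha
    rw [← hgc fun i => ⟨a i, ha i⟩]
    congr 1
    funext i
    exact τS _ (ha i)
  let Tc : Set (Fin n → P) := {t | ∀ i, t i ∈ c.support}
  let Tp : Set (Fin n → P) := {t | ∀ i, t i = p ∨ t i ∈ S}
  let F : (Fin n → P) → P := fun x => if x ∈ Tc then c.op x else g fun i => τ (x i)
  have Fc : ∀ x ∈ Tc, F x = c.op x := fun x hx => if_pos hx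
  have Fp : ∀ x ∈ Tp, F x = g fun i => τ (x i) := by
    intro x hx
    by_cases hxc : x ∈ Tc
    · rw [Fc x hxc, hgτ]
      exact fun i => (hx i).resolve_left fun h => hpc (h ▸ hxc i)
    · exact if_neg hxc
  have hF : MonotoneOn F (Tc ∪ Tp) := by
    rintro x (hx | hx) y (hy | hy) hxy
    · rw [Fc x hx, Fc y hy]; exact c.mono hx hy hxy
    · have : ∀ i, ∃ a ∈ S, x i ≤ a ∧ a ≤ y i := by
        intro i
        rcases hy i with h | h
        · obtain ⟨a, ha, h₁, h₂⟩ := (hp (x i) (hx i)).1.1 (h ▸ hxy i)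
          exact ⟨a, ha, h₁, h ▸ (hpq a ha).1.2 h₂⟩
        · exact ⟨y i, h, hxy i, le_rfl⟩
      choose a ha hxa hay using this
      rw [Fc x hx, Fp y hy]
      calc c.op x ≤ c.op a := c.mono hx (fun i => hS (ha i)) hxa
        _ = g fun i => τ (a i) := (hgτ a ha).symm
        _ ≤ _ := hg fun i => τmono _ _ (Or.inr (ha i)) (hy i) (hay i)
    · have : ∀ i, ∃ a ∈ S, x i ≤ a ∧ a ≤ y i := by
        intro i
        rcases hx i with h | h
        · obtain ⟨a, ha, h₁, h₂⟩ := (hp (y i) (hy i)).2.1 (h ▸ hxy i)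
          exact ⟨a, ha, h ▸ (hpq a ha).2.2 h₁, h₂⟩
        · exact ⟨x i, h, le_rfl, hxy i⟩
      choose a ha hxa hay using this
      rw [Fp x hx, Fc y hy]
      calc (g fun i => τ (x i)) ≤ g fun i => τ (a i) :=
            hg fun i => τmono _ _ (hx i) (Or.inr (ha i)) (hxa i)
        _ = c.op a := hgτ a ha
        _ ≤ _ := c.mono (fun i => hS (ha i)) hy hay
    · rw [Fp x hx, Fp y hy]; exact hg fun i => τmono _ _ (hx i) (hy i) (hxy i)
  have hTp : Tp.Finite :=
    (finite_tuples (insert p S)).subset fun t ht i => Finset.mem_insert.2 (ht i)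
  obtain ⟨d, hd, hEq⟩ :=
    exists_extend hP (insert p c.support) ((finite_tuples c.support).union hTp) F hF
  refine ⟨d, ⟨hd ▸ Finset.subset_insert _ _, fun t ht => ?_⟩, p, hd ▸ Finset.mem_insert_self _ _,
    hpq, fun t t' ht => ?_⟩
  · rw [hEq (Or.inl ht), Fc t ht]
  · have ht' : t' ∈ Tp := fun i => (ht i).imp And.right fun h => by rw [h.2]; exact h.1
    rw [hEq (Or.inr ht'), Fp t' ht']
    congr 1
    funext i
    rcases ht i with ⟨h, h'⟩ | ⟨h, h'⟩
    · rw [h', τp]; exact Subtype.ext h.symm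
    · rw [h', τS _ h]

end PolApprox

/-- An operation is saturated if it realizes every one-point extension, labelled by a monotone
operation into `P`, of each of its finite restrictions. -/
def IsSaturatedOp {n : ℕ} {P : Type} [PartialOrder P] (u : (Fin n → P) → P) : Prop :=
  ∀ (S : Finset P) (q : P), q ∉ S → ∀ g : (Fin n → ↥(insert q (S : Set P))) → P, Monotone g →
    (∀ t : Fin n → S, g (fun i => ⟨t i, Or.inr (t i).2⟩) = u fun i => t i) →
    ∃ p, PolApprox.Realizes u S q g p

lemma exists_forall_le_nat {n : ℕ} (k : Fin n → ℕ) : ∃ m, ∀ i, k i ≤ m :=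
  ⟨Finset.univ.sup k, fun i => Finset.le_sup (Finset.mem_univ i)⟩

lemma exists_monotone_isSaturatedOp (n : ℕ) {P : Type} [PartialOrder P] [Countable P]
    [Nonempty P] (hP : HasOnePointExt P) :
    ∃ u : (Fin n → P) → P, Monotone u ∧ IsSaturatedOp u := by
  classical
  let I := P ⊕ (Σ (S : Finset P) (q : P), ((Fin n → ↥(insert q (S : Set P))) → P))
  let D : I → Set (PolApprox n P)
    | .inl p => {c | p ∈ c.support}
    | .inr ⟨S, q, g⟩ => {c | S ⊆ c.support ∧ (q ∉ S → Monotone g →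
        (∀ t : Fin n → S, g (fun i => ⟨t i, Or.inr (t i).2⟩) = c.op fun i => t i) →
        ∃ p ∈ c.support, PolApprox.Realizes c.op S q g p)}
  have hD : ∀ i c, ∃ c' ∈ D i, c ≤ c' := by
    rintro (p | ⟨S, q, g⟩) c
    · obtain ⟨d, hd, hp⟩ := c.exists_le_support hP {p}
      exact ⟨d, hp (Finset.mem_singleton_self p), hd⟩
    · obtain ⟨d, hd, hS⟩ := c.exists_le_support hP S
      by_cases h : q ∉ S ∧ Monotone g ∧
        ∀ t : Fin n → S, g (fun i => ⟨t i, Or.inr (t i).2⟩) = d.op fun i => t i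
      · obtain ⟨e, he, hr⟩ := d.exists_realizes hP hS h.1 h.2.1 h.2.2
        exact ⟨e, ⟨hS.trans he.1, fun _ _ _ => hr⟩, hd.trans he⟩
      · exact ⟨d, ⟨hS, fun h₁ h₂ h₃ => (h ⟨h₁, h₂, h₃⟩).elim⟩, hd⟩
  let c₀ : PolApprox n P := ⟨∅, fun _ => Classical.arbitrary P, fun _ _ _ _ _ => le_rfl⟩
  obtain ⟨s, hs, -, hsD⟩ := exists_monotone_seq_meeting c₀ D hD
  have hdef : ∀ t : Fin n → P, ∃ k, ∀ i, t i ∈ (s k).support := by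
    intro t
    choose k hk using fun i => hsD (.inl (t i))
    obtain ⟨m, hm⟩ := exists_forall_le_nat k
    exact ⟨m, fun i => (hs (hm i)).1 (hk i)⟩
  choose K hK using hdef
  have hu : ∀ (k : ℕ) (t : Fin n → P), (∀ i, t i ∈ (s k).support) →
      (s (K t)).op t = (s k).op t := by
    intro k t ht
    rw [← (hs (le_max_left k (K t))).2 t ht, (hs (le_max_right k (K t))).2 t (hK t)]
  refine ⟨fun t => (s (K t)).op t, fun x y hxy => ?_, fun S q hq g hg hgu => ?_⟩
  · have hx : ∀ i, x i ∈ (s (max (K x) (K y))).support := fun i =>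
      (hs (le_max_left _ _)).1 (hK x i)
    have hy : ∀ i, y i ∈ (s (max (K x) (K y))).support := fun i =>
      (hs (le_max_right _ _)).1 (hK y i)
    change (s (K x)).op x ≤ (s (K y)).op y
    rw [hu _ x hx, hu _ y hy]
    exact (s _).mono hx hy hxy
  · obtain ⟨k, hS, hk⟩ := hsD (.inr ⟨S, q, g⟩)
    obtain ⟨p, hp, hpq, hr⟩ := hk hq hg fun t =>
      (hgu t).trans (hu k _ fun i => hS (t i).2)
    refine ⟨p, hpq, fun t t' ht => ?_⟩
    rw [← hr t t' ht]
    exact hu k t' fun i => (ht i).elim (fun h => h.2 ▸ hp) (fun h => h.2 ▸ hS h.1)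

/-- A finite partial isomorphism between the ordered sets `A` and `P` labelled by the operations
`f` and `u`. -/
def IsPartialIso {n : ℕ} {A P : Type} [PartialOrder A] [PartialOrder P] (f : (Fin n → A) → P)
    (u : (Fin n → P) → P) (R : Finset (A × P)) : Prop :=
  (∀ r ∈ R, ∀ r' ∈ R, r.1 ≤ r'.1 ↔ r.2 ≤ r'.2) ∧
    ∀ r : Fin n → A × P, (∀ i, r i ∈ R) → f (fun i => (r i).1) = u fun i => (r i).2

namespace IsPartialIso

variable {n : ℕ} {A P : Type} [PartialOrder A] [PartialOrder P] {f : (Fin n → A) → P}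
  {u : (Fin n → P) → P} {R : Finset (A × P)}

open Classical in
lemma exists_forth (hP : HasOnePointExt P) (hu : IsSaturatedOp u) (hf : Monotone f)
    (hR : IsPartialIso f u R) (a : A) :
    ∃ R', IsPartialIso f u R' ∧ R ⊆ R' ∧ ∃ p, (a, p) ∈ R' := by
  by_cases haR : ∃ p, (a, p) ∈ R
  · exact ⟨R, hR, Finset.Subset.refl _, haR⟩
  have hne : ∀ r ∈ R, r.1 ≠ a := fun r hr h => haR ⟨r.2, h ▸ hr⟩
  obtain ⟨hle, hlab⟩ := hR
  let S : Finset P := R.image Prod.snd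
  have memS : ∀ {x}, x ∈ S → ∃ r ∈ R, r.2 = x := fun hx => by simpa [S] using hx
  obtain ⟨q, hq⟩ := hP S (fun s => ∃ r ∈ R, s ≤ r.2 ∧ r.1 ≤ a) (fun s => ∃ r ∈ R, r.2 ≤ s ∧ a ≤ r.1)
    (fun s _ s' _ h ⟨r, hr, h₁, h₂⟩ => ⟨r, hr, h.trans h₁, h₂⟩)
    (fun s _ s' _ h ⟨r, hr, h₁, h₂⟩ => ⟨r, hr, h₁.trans h, h₂⟩)
    (fun s _ s' _ ⟨r, hr, h₁, h₂⟩ ⟨r', hr', h₃, h₄⟩ =>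
      h₁.trans (((hle r hr r' hr').1 (h₂.trans h₄)).trans h₃))
    (fun s _ ⟨r, hr, h₁, h₂⟩ ⟨r', hr', h₃, h₄⟩ =>
      hne r hr (le_antisymm h₂ (h₄.trans ((hle r' hr' r hr).2 (h₃.trans h₁)))))
  have hqR : ∀ r ∈ R, (r.2 ≤ q ↔ r.1 ≤ a) ∧ (q ≤ r.2 ↔ a ≤ r.1) := fun r hr =>
    have h := hq r.2 (Finset.mem_image_of_mem _ hr)
    ⟨h.1.trans ⟨fun ⟨r', hr', h₁, h₂⟩ => ((hle r hr r' hr').2 h₁).trans h₂,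
        fun h => ⟨r, hr, le_rfl, h⟩⟩,
      h.2.trans ⟨fun ⟨r', hr', h₁, h₂⟩ => h₂.trans ((hle r' hr' r hr).2 h₁),
        fun h => ⟨r, hr, le_rfl, h⟩⟩⟩
  have hqS : q ∉ S := fun h => by
    obtain ⟨r, hr, rfl⟩ := memS h
    exact hne r hr (le_antisymm ((hqR r hr).1.1 le_rfl) ((hqR r hr).2.1 le_rfl))
  have hπ : ∀ x : ↥(insert q (S : Set P)), ∃ b : A,
      ((x : P) = q ∧ b = a) ∨ (b, (x : P)) ∈ R := by
    rintro ⟨x, rfl | hx⟩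
    · exact ⟨a, Or.inl ⟨rfl, rfl⟩⟩
    · obtain ⟨r, hr, rfl⟩ := memS hx
      exact ⟨r.1, Or.inr hr⟩
  choose π hπ using hπ
  have πmono : Monotone π := by
    intro x y hxy
    have hxy' : (x : P) ≤ y := hxy
    rcases hπ x with ⟨hx, hx'⟩ | hx <;> rcases hπ y with ⟨hy, hy'⟩ | hy
    · rw [hx', hy']
    · rw [hx']; exact (hqR _ hy).2.1 (hx.ge.trans hxy')
    · rw [hy']; exact (hqR _ hx).1.1 (hxy'.trans hy.le)
    · exact (hle _ hx _ hy).2 hxy'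
  have πR : ∀ r (hr : r ∈ R) (h : r.2 ∈ insert q (S : Set P)), π ⟨r.2, h⟩ = r.1 := by
    intro r hr h
    rcases hπ ⟨r.2, h⟩ with ⟨hx, -⟩ | hx
    · exact (hqS (hx ▸ Finset.mem_image_of_mem _ hr)).elim
    · exact le_antisymm ((hle _ hx _ hr).2 le_rfl) ((hle _ hr _ hx).2 le_rfl)
  have πq : ∀ h, π ⟨q, h⟩ = a := by
    intro h
    rcases hπ ⟨q, h⟩ with ⟨-, hx⟩ | hx
    · exact hx
    · exact (hqS (Finset.mem_image_of_mem Prod.snd hx)).elim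
  obtain ⟨p, hpq, hreal⟩ := hu S q hqS (fun t => f fun i => π (t i))
    (fun t t' h => hf fun i => πmono (h i)) (fun t => by
      choose r hr hrt using fun i => memS (t i).2
      rw [← funext hrt, ← hlab r hr]
      congr 1
      funext i
      exact (congrArg π (Subtype.ext (hrt i).symm)).trans
        (πR (r i) (hr i) (Or.inr (Finset.mem_image_of_mem _ (hr i)))))
  have hpR : ∀ r ∈ R, (r.1 ≤ a ↔ r.2 ≤ p) ∧ (a ≤ r.1 ↔ p ≤ r.2) := fun r hr =>
    have h := hpq r.2 (Finset.mem_image_of_mem _ hr)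
    ⟨(h.1.trans (hqR r hr).1).symm, (h.2.trans (hqR r hr).2).symm⟩
  refine ⟨insert (a, p) R, ⟨?_, fun r hr => ?_⟩, Finset.subset_insert _ _, p,
    Finset.mem_insert_self _ _⟩
  · intro r hr r' hr'
    rcases Finset.mem_insert.1 hr with rfl | hr <;> rcases Finset.mem_insert.1 hr' with rfl | hr'
    · simp
    · exact (hpR r' hr').2
    · exact (hpR r hr).1
    · exact hle r hr r' hr'
  · have ht : ∀ i, ∃ x : ↥(insert q (S : Set P)), π x = (r i).1 ∧
        (((x : P) = q ∧ (r i).2 = p) ∨ ((x : P) ∈ S ∧ (r i).2 = x)) := by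
      intro i
      rcases Finset.mem_insert.1 (hr i) with h | h
      · exact ⟨⟨q, Or.inl rfl⟩, (πq _).trans (by rw [h]), Or.inl ⟨rfl, by rw [h]⟩⟩
      · have hS : (r i).2 ∈ S := Finset.mem_image_of_mem _ h
        exact ⟨⟨(r i).2, Or.inr hS⟩, πR _ h _, Or.inr ⟨hS, rfl⟩⟩
    choose t htπ ht using ht
    exact (congrArg f (funext htπ).symm).trans (hreal t _ ht).symm

lemma swap {u' : (Fin n → P) → P} {R : Finset (P × P)} (hR : IsPartialIso u u' R) :
    IsPartialIso u' u (R.map (Equiv.prodComm P P).toEmbedding) := by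
  refine ⟨fun r hr r' hr' => ?_, fun r hr => ?_⟩
  · simp only [Finset.mem_map_equiv] at hr hr'
    exact (hR.1 _ hr _ hr').symm
  · simp only [Finset.mem_map_equiv] at hr
    exact (hR.2 (fun i => (r i).swap) hr).symm

/-- Every finite partial isomorphism extends to an embedding of labelled ordered sets. -/
lemma exists_embedding [Countable A] (hP : HasOnePointExt P) (hu : IsSaturatedOp u)
    (hf : Monotone f) (hR : IsPartialIso f u R) :
    ∃ h : A → P, (∀ a b, a ≤ b ↔ h a ≤ h b) ∧ ∀ t, f t = u fun i => h (t i) := by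
  obtain ⟨s, hs, -, hsD⟩ := exists_monotone_seq_meeting
    (C := {R : Finset (A × P) // IsPartialIso f u R}) ⟨R, hR⟩
    (fun a => {c | ∃ p, (a, p) ∈ c.1}) (fun a c => by
      obtain ⟨R', hR', hsub, hp⟩ := exists_forth hP hu hf c.2 a
      exact ⟨⟨R', hR'⟩, hp, hsub⟩)
  choose k h hk using hsD
  refine ⟨h, fun a b => ?_, fun t => ?_⟩
  · exact (s (max (k a) (k b))).2.1 _ (hs (le_max_left _ _) (hk a)) _
      (hs (le_max_right _ _) (hk b))
  · obtain ⟨m, hm⟩ := exists_forall_le_nat fun i => k (t i)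
    exact (s m).2.2 (fun i => (t i, h (t i))) fun i => hs (hm i) (hk (t i))

/-- Every finite partial self-isomorphism extends to an automorphism of the labelled ordered
set. -/
lemma exists_automorphism [Countable P] (hP : HasOnePointExt P) (hu : IsSaturatedOp u)
    (hmono : Monotone u) {R : Finset (P × P)} (hR : IsPartialIso u u R) :
    ∃ h : P → P, Function.Surjective h ∧ (∀ a b, a ≤ b ↔ h a ≤ h b) ∧
      (∀ r ∈ R, h r.1 = r.2) ∧ ∀ t, u (fun i => h (t i)) = u t := by
  obtain ⟨s, hs, h0, hsD⟩ := exists_monotone_seq_meeting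
    (C := {R : Finset (P × P) // IsPartialIso u u R}) ⟨R, hR⟩
    (Sum.elim (fun a => {c | ∃ p, (a, p) ∈ c.1}) (fun p => {c | ∃ a, (a, p) ∈ c.1})) (by
      rintro (a | p) c
      · obtain ⟨R', hR', hsub, hp⟩ := exists_forth hP hu hmono c.2 a
        exact ⟨⟨R', hR'⟩, hp, hsub⟩
      · obtain ⟨R', hR', hsub, a, ha⟩ := exists_forth hP hu hmono c.2.swap p
        refine ⟨⟨_, hR'.swap⟩, ⟨a, by simpa [Finset.mem_map_equiv] using ha⟩, fun r hr => ?_⟩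
        rw [Finset.mem_map_equiv]
        exact hsub (by rw [Finset.mem_map_equiv]; exact hr))
  choose k h hk using fun a => hsD (.inl a)
  have huniq : ∀ {m a p}, (a, p) ∈ (s m).1 → h a = p := by
    intro m a p hp
    have h₁ := hs (le_max_left (k a) m) (hk a)
    have h₂ := hs (le_max_right (k a) m) hp
    have hiff := (s (max (k a) m)).2.1
    exact le_antisymm ((hiff _ h₁ _ h₂).1 le_rfl) ((hiff _ h₂ _ h₁).1 le_rfl)
  refine ⟨h, fun p => ?_, fun a b => ?_, fun r hr => huniq (h0 hr), fun t => ?_⟩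
  · obtain ⟨m, a, ha⟩ := hsD (.inr p)
    exact ⟨a, huniq ha⟩
  · exact (s (max (k a) (k b))).2.1 _ (hs (le_max_left _ _) (hk a)) _
      (hs (le_max_right _ _) (hk b))
  · obtain ⟨m, hm⟩ := exists_forall_le_nat fun i => k (t i)
    exact ((s m).2.2 (fun i => (t i, h (t i))) fun i => hs (hm i) (hk (t i))).symm

end IsPartialIso

lemma isEmb_ordStruc_iff {A : RelStr sigOrd} {P : Type} [PartialOrder P] {h : A.carrier → P}
    (hh : RelStr.IsEmb A (ordStruc P) h) (a b : A.carrier) : ![a, b] ∈ A.rel () ↔ h a ≤ h b :=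
  hh.2 () ![a, b]

/-- A structure whose age consists of posets is a poset. -/
abbrev partialOrderOfYounger {A : RelStr sigOrd} {P : Type} [PartialOrder P]
    (hA : RelStr.Younger A (ordStruc P)) : PartialOrder A.carrier :=
  have key : ∀ s : Set A.carrier, s.Finite → ∃ h : s → P, Function.Injective h ∧
      ∀ a b : s, ![(a : A.carrier), (b : A.carrier)] ∈ A.rel () ↔ h a ≤ h b := by
    intro s hs
    let B : RelStr sigOrd := ⟨s, fun r => {t | (fun j => (t j : A.carrier)) ∈ A.rel r}⟩
    obtain ⟨-, h, hh⟩ := hA B ⟨hs, Subtype.val, Subtype.val_injective, fun _ _ => Iff.rfl⟩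
    refine ⟨h, hh.1, fun a b => ?_⟩
    rw [← isEmb_ordStruc_iff hh a b]
    change _ ↔ (fun j => ((![a, b] : Fin 2 → s) j : A.carrier)) ∈ A.rel ()
    congr! 1
    funext j
    fin_cases j <;> rfl
  { le := fun a b => ![a, b] ∈ A.rel ()
    le_refl := fun a => by
      obtain ⟨h, -, hh⟩ := key {a} (Set.toFinite _)
      exact (hh ⟨a, by simp⟩ ⟨a, by simp⟩).2 le_rfl
    le_trans := fun a b c hab hbc => by
      obtain ⟨h, -, hh⟩ := key {a, b, c} (Set.toFinite _)
      exact (hh ⟨a, by simp⟩ ⟨c, by simp⟩).2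
        (((hh ⟨a, by simp⟩ ⟨b, by simp⟩).1 hab).trans ((hh ⟨b, by simp⟩ ⟨c, by simp⟩).1 hbc))
    le_antisymm := fun a b hab hba => by
      obtain ⟨h, hinj, hh⟩ := key {a, b} (Set.toFinite _)
      exact congrArg Subtype.val (hinj (le_antisymm
        ((hh ⟨a, by simp⟩ ⟨b, by simp⟩).1 hab) ((hh ⟨b, by simp⟩ ⟨a, by simp⟩).1 hba))) }

/-- The generic poset — i.e. a countable homogeneous poset (with
reflexive order relation) into which every finite poset embeds — has universal
homogeneous polymorphisms of every arity `n ≥ 1`. -/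
theorem stmt_14 (P : Type) [PartialOrder P] (hc : Countable P)
    (hhom : RelStr.IsHomogeneous (ordStruc P))
    (hage : ∀ (Q : Type) [PartialOrder Q] [Finite Q],
      ∃ ι : Q → P, ∀ a b : Q, ι a ≤ ι b ↔ a ≤ b) :
    ∀ n : ℕ, 0 < n → ∃ u : (Fin n → P) → P,
      IsUniversalPolymorphism (ordStruc P) n u ∧
      IsHomogeneousPolymorphism (ordStruc P) n u := by
  intro n hn
  have hP := hasOnePointExt_of_isHomogeneous P hhom hage
  have : Nonempty P := ⟨(hage Unit).choose ()⟩
  obtain ⟨u, hmono, hu⟩ := exists_monotone_isSaturatedOp n hP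
  have hpol : IsPolymorphism (ordStruc P) n u := fun _ t ht =>
    @hmono (t (0 : Fin 2)) (t (1 : Fin 2)) fun i => ht i
  refine ⟨u, ⟨hpol, fun A hA hAP (f : (Fin n → A.carrier) → P) hf => ?_⟩, hpol, 
    fun A hA f _ (ι₁ ι₂ : A.carrier → P) h₁ h₂ hf₁ hf₂ => ?_⟩
  · let inst : PartialOrder A.carrier := partialOrderOfYounger hAP
    have hfm : Monotone f := fun x y hxy =>
      hf () (![x, y] : Fin 2 → Fin n → A.carrier) fun i => by
      have : (fun j => (![x, y] : Fin 2 → Fin n → A.carrier) j i) = ![x i, y i] := by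
        funext j
        fin_cases j <;> rfl
      exact this ▸ hxy i
    obtain ⟨h, hle, hlab⟩ := IsPartialIso.exists_embedding (R := ∅) hP hu hfm
      ⟨by simp, fun r hr => absurd (hr ⟨0, hn⟩) (Finset.notMem_empty _)⟩
    refine ⟨h, ⟨fun a b (hab : h a = h b) => le_antisymm ((hle a b).2 hab.le) ((hle b a).2 hab.ge),
      fun _ t => ?_⟩, hlab⟩
    have : t = (![t (0 : Fin 2), t (1 : Fin 2)] : Fin 2 → A.carrier) := by
      funext (j : Fin 2)
      fin_cases j <;> rfl
    rw [this]
    exact hle (t (0 : Fin 2)) (t (1 : Fin 2))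
  · have := hA.1
    have hfin : (Set.range fun a => (ι₁ a, ι₂ a)).Finite := Set.finite_range _
    obtain ⟨h, hsurj, hle, hext, hlab⟩ := IsPartialIso.exists_automorphism hP hu hmono
      (R := hfin.toFinset) ⟨fun r hr r' hr' => by
        obtain ⟨a, rfl⟩ := hfin.mem_toFinset.1 hr
        obtain ⟨b, rfl⟩ := hfin.mem_toFinset.1 hr'
        exact (isEmb_ordStruc_iff h₁ a b).symm.trans (isEmb_ordStruc_iff h₂ a b), fun r hr => by
        choose t ht using fun i => hfin.mem_toFinset.1 (hr i)
        rw [← funext ht]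
        exact (hf₁ t).trans (hf₂ t).symm⟩
    exact ⟨h, ⟨hsurj, isEmb_ordStruc fun a b => (hle a b).symm⟩,
      fun a => hext (ι₁ a, ι₂ a) (hfin.mem_toFinset.2 ⟨a, rfl⟩), hlab⟩
end

section
/- For every n > 1, the class of finite metric spaces (with nonexpansive maps as homomorphisms and isometric embeddings as embeddings, and with the maximum-metric as the n-th power) does not have the AEPⁿ. That is, there exist finite metric spaces A, B₁, B₂, T, isometric embeddings f_i : A ↪ B_i and nonexpansive maps h_i : B_iⁿ → T (i = 1,2) with h₁∘f₁ⁿ = h₂∘f₂ⁿ, such that there are NO finite metric spaces C, T′, isometric embeddings g_i : B_i ↪ C with g₁∘f₁ = g₂∘f₂, isometric embedding k : T ↪ T′, and nonexpansive map h : Cⁿ → T′ with h∘g_iⁿ = k∘h_i (i = 1,2). -/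
set_option autoImplicit false

/-- Isometric embedding (distance preserving map) of metric spaces. -/
def IsomEmb {α β : Type} [MetricSpace α] [MetricSpace β] (f : α → β) : Prop :=
  ∀ x y : α, dist (f x) (f y) = dist x y

/-- A nonexpansive map from the `n`-th power of a metric space (with the
maximum-metric, which is the metric of `Fin n → α`) to a metric space. -/
def NonExpansivePow {α β : Type} [MetricSpace α] [MetricSpace β] (n : ℕ)
    (f : (Fin n → α) → β) : Prop :=
  ∀ x y : Fin n → α, dist (f x) (f y) ≤ dist x y

/-- The truncated cone of height `2` around `t` is `1`-Lipschitz. -/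
lemma abs_max_zero_two_sub_dist_sub_le {X : Type} [PseudoMetricSpace X] (t x y : X) :
    |max 0 (2 - dist x t) - max 0 (2 - dist y t)| ≤ dist x y := by
  rw [max_comm 0, max_comm 0]
  refine (abs_max_sub_max_le_abs _ _ 0).trans ?_
  rw [sub_sub_sub_cancel_left, dist_comm x y]
  exact abs_dist_sub_le y x t

/-- If `B₁` and `B₂` embed into `C` with a common point, two tuples whose coordinates are joined
through that point by paths of length at most `r` are at distance at most `r`. -/
lemma dist_comp_le_of_isomEmb {B₁ B₂ C : Type} [MetricSpace B₁] [MetricSpace B₂] [MetricSpace C]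
    {n : ℕ} {g₁ : B₁ → C} {g₂ : B₂ → C} (hg₁ : IsomEmb g₁) (hg₂ : IsomEmb g₂)
    {a₁ : B₁} {a₂ : B₂} (ha : g₁ a₁ = g₂ a₂) {t : Fin n → B₁} {s : Fin n → B₂} {r : ℝ}
    (hr : 0 ≤ r) (hts : ∀ i, dist (t i) a₁ + dist a₂ (s i) ≤ r) :
    dist (fun i => g₁ (t i)) (fun i => g₂ (s i)) ≤ r := by
  refine (dist_pi_le_iff hr).2 fun i => (dist_triangle _ (g₁ a₁) _).trans ?_
  rw [hg₁, ha, hg₂]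
  exact hts i

/-- For every `n > 1`, the class of finite metric spaces does not have
the AEPⁿ: there are finite metric spaces `A, B₁, B₂, T`, isometric embeddings
`f_i : A ↪ B_i` and nonexpansive maps `h_i : B_iⁿ → T` with `h₁ ∘ f₁ⁿ = h₂ ∘ f₂ⁿ`, such
that there are no finite metric spaces `C, T'`, isometric embeddings `g_i : B_i ↪ C`
with `g₁ ∘ f₁ = g₂ ∘ f₂`, isometric embedding `k : T ↪ T'` and nonexpansive map
`h : Cⁿ → T'` with `h ∘ g_iⁿ = k ∘ h_i` (`i = 1, 2`). -/
theorem stmt_15 (n : ℕ) (hn : 1 < n) :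
    ∃ (A B₁ B₂ T : Type) (iA : MetricSpace A) (iB₁ : MetricSpace B₁)
      (iB₂ : MetricSpace B₂) (iT : MetricSpace T),
      Finite A ∧ Finite B₁ ∧ Finite B₂ ∧ Finite T ∧
      ∃ (f₁ : A → B₁) (f₂ : A → B₂) (h₁ : (Fin n → B₁) → T) (h₂ : (Fin n → B₂) → T),
        @IsomEmb A B₁ iA iB₁ f₁ ∧ @IsomEmb A B₂ iA iB₂ f₂ ∧
        @NonExpansivePow B₁ T iB₁ iT n h₁ ∧ @NonExpansivePow B₂ T iB₂ iT n h₂ ∧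
        (∀ t : Fin n → A, h₁ (fun i => f₁ (t i)) = h₂ (fun i => f₂ (t i))) ∧
        ¬ ∃ (C T' : Type) (iC : MetricSpace C) (iT' : MetricSpace T'),
            Finite C ∧ Finite T' ∧
            ∃ (g₁ : B₁ → C) (g₂ : B₂ → C) (k : T → T') (h : (Fin n → C) → T'),
              @IsomEmb B₁ C iB₁ iC g₁ ∧ @IsomEmb B₂ C iB₂ iC g₂ ∧
              (∀ a : A, g₁ (f₁ a) = g₂ (f₂ a)) ∧
              @IsomEmb T T' iT iT' k ∧
              @NonExpansivePow C T' iC iT' n h ∧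
              (∀ t : Fin n → B₁, h (fun i => g₁ (t i)) = k (h₁ t)) ∧
              (∀ t : Fin n → B₂, h (fun i => g₂ (t i)) = k (h₂ t)) := by
  let B : Type := ({0, 1, 2} : Set ℝ)
  have hB : Finite B := Set.Finite.to_subtype (by simp)
  let a : B := ⟨0, by simp⟩
  let p : B := ⟨1, by simp⟩
  let q : B := ⟨2, by simp⟩
  have hap : dist a p = 1 := by
    change dist (0 : ℝ) 1 = 1
    simp [Real.dist_eq]
  have haq : dist a q = 2 := by
    change dist (0 : ℝ) 2 = 2
    simp [Real.dist_eq]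
  let i₀ : Fin n := ⟨0, by omega⟩
  let i₁ : Fin n := ⟨1, hn⟩
  have hi : i₁ ≠ i₀ := by simp [i₀, i₁]
  let t : Fin n → B := fun i => if i = i₀ then p else q
  let s : Fin n → B := fun i => if i = i₀ then q else p
  have hat : 2 ≤ dist (fun _ => a) t := by
    have := dist_le_pi_dist (fun _ => a) t i₁
    simpa [t, hi, haq] using this
  have has : 2 ≤ dist (fun _ => a) s := by
    have := dist_le_pi_dist (fun _ => a) s i₀
    simpa [s, haq] using this
  let u : (Fin n → B) → ℝ := fun x => -max 0 (2 - dist x t)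
  let v : (Fin n → B) → ℝ := fun x => max 0 (2 - dist x s)
  let T : Type := (Set.range u ∪ Set.range v : Set ℝ)
  have hT : Finite T :=
    Set.Finite.to_subtype ((Set.finite_range u).union (Set.finite_range v))
  refine ⟨Unit, B, B, T, inferInstance, inferInstance, inferInstance, inferInstance,
    inferInstance, hB, hB, hT, fun _ => a, fun _ => a,
    fun x => ⟨u x, Or.inl ⟨x, rfl⟩⟩, fun x => ⟨v x, Or.inr ⟨x, rfl⟩⟩, ?_, ?_, ?_, ?_, ?_, ?_⟩
  · intro x y
    simp
  · intro x y
    simp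
  · intro x y
    rw [Subtype.dist_eq, Real.dist_eq]
    simp only [u]
    rw [neg_sub_neg, abs_sub_comm]
    exact abs_max_zero_two_sub_dist_sub_le t x y
  · intro x y
    rw [Subtype.dist_eq, Real.dist_eq]
    exact abs_max_zero_two_sub_dist_sub_le s x y
  · intro _
    refine Subtype.ext ?_
    simp only [u, v]
    rw [max_eq_left (by linarith), max_eq_left (by linarith), neg_zero]
  · rintro ⟨C, T', iC, iT', -, -, g₁, g₂, k, h, hg₁, hg₂, hg, hk, hh, hk₁, hk₂⟩
    have hC : dist (fun i => g₁ (t i)) (fun i => g₂ (s i)) ≤ 3 := by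
      refine dist_comp_le_of_isomEmb hg₁ hg₂ (hg ()) (by norm_num) fun i => ?_
      rw [dist_comm]
      by_cases h0 : i = i₀
      · simp only [t, s, if_pos h0, hap, haq]
        norm_num
      · simp only [t, s, if_neg h0, hap, haq]
        norm_num
    have hT' := (hh _ _).trans hC
    rw [hk₁, hk₂, hk, Subtype.dist_eq, Real.dist_eq] at hT'
    simp only [u, v, dist_self] at hT'
    norm_num at hT'
end

section
/- For every n ≥ 2, the class of finite chains (finite linearly ordered sets with reflexive order relation) does not have the AEPⁿ. That is, there exist finite chains A, B₁, B₂, T, order embeddings f_i : A ↪ B_i and monotone maps h_i : B_iⁿ → T (i = 1,2) with h₁∘f₁ⁿ = h₂∘f₂ⁿ, such that there are NO finite chains C, T′, order embeddings g_i : B_i ↪ C with g₁∘f₁ = g₂∘f₂, order embedding k : T ↪ T′, and monotone map h : Cⁿ → T′ with h∘g_iⁿ = k∘h_i (i = 1,2). -/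
set_option autoImplicit false

/-- Order embedding of linear orders. -/
def OrdEmb {α β : Type} [LinearOrder α] [LinearOrder β] (f : α → β) : Prop :=
  ∀ a b : α, f a ≤ f b ↔ a ≤ b

/-- A monotone map from the `n`-th power of a chain (with the componentwise order)
to a chain. -/
def MonotonePow {α β : Type} [LinearOrder α] [LinearOrder β] (n : ℕ)
    (f : (Fin n → α) → β) : Prop :=
  ∀ x y : Fin n → α, (∀ i, x i ≤ y i) → f x ≤ f y

/-- For every `n ≥ 2`, the class of finite chains (with reflexive order
relation) does not have the AEPⁿ: there are finite chains `A, B₁, B₂, T`, order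
embeddings `f_i : A ↪ B_i` and monotone maps `h_i : B_iⁿ → T` with `h₁ ∘ f₁ⁿ = h₂ ∘ f₂ⁿ`,
such that there are no finite chains `C, T'`, order embeddings `g_i : B_i ↪ C` with
`g₁ ∘ f₁ = g₂ ∘ f₂`, order embedding `k : T ↪ T'` and monotone map `h : Cⁿ → T'` with
`h ∘ g_iⁿ = k ∘ h_i` (`i = 1, 2`). -/
theorem stmt_16 (n : ℕ) (hn : 2 ≤ n) :
    ∃ (A B₁ B₂ T : Type) (iA : LinearOrder A) (iB₁ : LinearOrder B₁)
      (iB₂ : LinearOrder B₂) (iT : LinearOrder T),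
      Finite A ∧ Finite B₁ ∧ Finite B₂ ∧ Finite T ∧
      ∃ (f₁ : A → B₁) (f₂ : A → B₂) (h₁ : (Fin n → B₁) → T) (h₂ : (Fin n → B₂) → T),
        @OrdEmb A B₁ iA iB₁ f₁ ∧ @OrdEmb A B₂ iA iB₂ f₂ ∧
        @MonotonePow B₁ T iB₁ iT n h₁ ∧ @MonotonePow B₂ T iB₂ iT n h₂ ∧
        (∀ t : Fin n → A, h₁ (fun i => f₁ (t i)) = h₂ (fun i => f₂ (t i))) ∧
        ¬ ∃ (C T' : Type) (iC : LinearOrder C) (iT' : LinearOrder T'),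
            Finite C ∧ Finite T' ∧
            ∃ (g₁ : B₁ → C) (g₂ : B₂ → C) (k : T → T') (h : (Fin n → C) → T'),
              @OrdEmb B₁ C iB₁ iC g₁ ∧ @OrdEmb B₂ C iB₂ iC g₂ ∧
              (∀ a : A, g₁ (f₁ a) = g₂ (f₂ a)) ∧
              @OrdEmb T T' iT iT' k ∧
              @MonotonePow C T' iC iT' n h ∧
              (∀ t : Fin n → B₁, h (fun i => g₁ (t i)) = k (h₁ t)) ∧
              (∀ t : Fin n → B₂, h (fun i => g₂ (t i)) = k (h₂ t)) := by
  have h01 : (⟨0, by omega⟩ : Fin n) ≠ ⟨1, by omega⟩ := by simp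
  generalize (⟨0, by omega⟩ : Fin n) = p at h01
  generalize (⟨1, by omega⟩ : Fin n) = q at h01
  refine ⟨Unit, Bool, Bool, Bool, inferInstance, inferInstance, inferInstance, inferInstance,
    inferInstance, inferInstance, inferInstance, inferInstance,
    fun _ => false, fun _ => false, fun t => t p, fun t => t q,
    fun _ _ => by simp, fun _ _ => by simp, fun _ _ h => h p, fun _ _ h => h q,
    fun _ => rfl, ?_⟩
  rintro ⟨C, T', iC, iT', -, -, g₁, g₂, k, h, -, -, hg, hk, hh, hh₁, hh₂⟩
  have hg₀ : g₁ false = g₂ false := hg ()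
  have hk' : ¬ k true ≤ k false := by simp [hk true false]
  rcases le_total (g₁ true) (g₂ true) with hle | hle
  · have hmono := hh (fun i => g₁ (decide (i = p))) (fun i => g₂ (decide (i = p))) fun i => by
      by_cases hi : i = p <;> simp [hi, hle, hg₀]
    rw [hh₁ fun i => decide (i = p), hh₂ fun i => decide (i = p)] at hmono
    exact hk' (by simpa [h01.symm] using hmono)
  · have hmono := hh (fun i => g₂ (decide (i = q))) (fun i => g₁ (decide (i = q))) fun i => by
      by_cases hi : i = q <;> simp [hi, hle, hg₀]
    rw [hh₂ fun i => decide (i = q), hh₁ fun i => decide (i = q)] at hmono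
    exact hk' (by simpa [h01] using hmono)
end

section
/- Let U be a countable homogeneous relational structure such that (1) Pol(U) contains all constant functions, (2) Age(U) has the free amalgamation property, (3) Age(U) is closed with respect to finite products, and (4) Age(U) has the homo-amalgamation property (HAP). Then Pol(U) has automatic homeomorphicity: every clone isomorphism from Pol(U) to the polymorphism clone of any countable relational structure is a homeomorphism with respect to the topologies of pointwise convergence. -/
set_option autoImplicit false

open RelStr

namespace RelStr

/-! ### Induced substructures and ages -/

/-- The substructure of `A` induced on the set `S`. -/
def induced {σ : RelSig} (A : RelStr σ) (S : Set A.carrier) : RelStr σ where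
  carrier := S
  rel s := {t | (fun j => (t j : A.carrier)) ∈ A.rel s}

theorem isEmb_induced_val {σ : RelSig} (A : RelStr σ) (S : Set A.carrier) :
    IsEmb (A.induced S) A Subtype.val :=
  ⟨Subtype.val_injective, fun _ _ => Iff.rfl⟩

theorem IsEmb.isHom {σ : RelSig} {A B : RelStr σ} {f : A.carrier → B.carrier}
    (hf : IsEmb A B f) : IsHom A B f :=
  fun s t ht => (hf.2 s t).1 ht

theorem IsHom.comp {σ : RelSig} {A B C : RelStr σ} {g : B.carrier → C.carrier}
    {f : A.carrier → B.carrier} (hg : IsHom B C g) (hf : IsHom A B f) :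
    IsHom A C (fun x => g (f x)) :=
  fun s t ht => hg s _ (hf s t ht)

theorem IsEmb.comp {σ : RelSig} {A B C : RelStr σ} {g : B.carrier → C.carrier}
    {f : A.carrier → B.carrier} (hg : IsEmb B C g) (hf : IsEmb A B f) :
    IsEmb A C (fun x => g (f x)) :=
  ⟨hg.1.comp hf.1, fun s t => (hf.2 s t).trans (hg.2 s _)⟩

theorem isEmb_inclusion {σ : RelSig} (A : RelStr σ) {S T : Set A.carrier} (h : S ⊆ T) :
    IsEmb (A.induced S) (A.induced T) (Set.inclusion h) :=
  ⟨Set.inclusion_injective h, fun _ _ => Iff.rfl⟩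

theorem inAge.of_isEmb {σ : RelSig} {U A B : RelStr σ} {g : A.carrier → B.carrier}
    (hB : inAge U B) (hg : IsEmb A B g) : inAge U A := by
  obtain ⟨hfin, d, hd⟩ := hB
  exact ⟨Finite.of_injective g hg.1, _, hd.comp hg⟩

theorem inAge_induced {σ : RelSig} (U : RelStr σ) {S : Set U.carrier} (hS : S.Finite) :
    inAge U (U.induced S) :=
  ⟨hS.to_subtype, _, isEmb_induced_val U S⟩

/-- In a homogeneous structure, extensions of finite substructures are realised over them. -/
theorem IsHomogeneous.exists_isEmb_fixing {σ : RelSig} {U : RelStr σ} (hhom : IsHomogeneous U)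
    {E : Set U.carrier} {D : RelStr σ} (hD : inAge U D)
    {g : (U.induced E).carrier → D.carrier} (hg : IsEmb (U.induced E) D g) :
    ∃ d : D.carrier → U.carrier, IsEmb D U d ∧ ∀ y, d (g y) = y.1 := by
  obtain ⟨d, hd⟩ := hD.2
  obtain ⟨h, hh, hfix⟩ := hhom _ (hD.of_isEmb hg) _ _ (hd.comp hg) (isEmb_induced_val U E)
  exact ⟨_, hh.2.comp hd, hfix⟩

/-- Under the HAP, finite partial endomorphisms extend to larger finite domains. -/
theorem exists_isHom_extension {σ : RelSig} {U : RelStr σ} (hhom : IsHomogeneous U)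
    (hhap : AgeHAP U) {E E' : Set U.carrier} (hE' : E'.Finite) (hEE' : E ⊆ E')
    {e : U.carrier → U.carrier} (he : IsHom (U.induced E) U (fun x => e x.1)) :
    ∃ e' : U.carrier → U.carrier, IsHom (U.induced E') U (fun x => e' x.1) ∧
      ∀ x ∈ E, e' x = e x := by
  classical
  have hE := hE'.subset hEE'
  obtain ⟨D, f', g', hD, hf', hg', hcomm⟩ := hhap (U.induced E) (U.induced (e '' E))
    (U.induced E') (inAge_induced U hE) (inAge_induced U (hE.image e)) (inAge_induced U hE')
    (fun x => ⟨e x.1, Set.mem_image_of_mem e x.2⟩) _ (fun s t ht => he s t ht)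
    (isEmb_inclusion U hEE')
  obtain ⟨d, hd, hfix⟩ := hhom.exists_isEmb_fixing hD hg'
  refine ⟨fun x => if hx : x ∈ E' then d (f' ⟨x, hx⟩) else x, ?_, fun x hx => ?_⟩
  · have : (fun x : (U.induced E').carrier =>
        if hx : x.1 ∈ E' then d (f' ⟨x.1, hx⟩) else x.1) = fun x => d (f' x) :=
      funext fun x => dif_pos x.2
    rw [this]
    exact hd.isHom.comp hf'
  · exact (dif_pos (hEE' hx)).trans ((congrArg d (hcomm ⟨x, hx⟩)).trans (hfix _))

/-- A finite partial embedding of `W` into `U` extends to a larger finite domain, freely over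
a given finite subset of `U`. -/
theorem exists_free_isEmb_extension {σ : RelSig} {U W : RelStr σ} (hhom : IsHomogeneous U)
    (hfap : AgeFAP U) {E : Set U.carrier} (hE : E.Finite) {D D' : Set W.carrier} (hDD' : D ⊆ D')
    (hD' : inAge U (W.induced D')) {ι : W.carrier → U.carrier}
    (hι : IsEmb (W.induced D) U (fun x => ι x.1)) (hιE : ∀ w ∈ D, ι w ∈ E) :
    ∃ ι' : W.carrier → U.carrier, IsEmb (W.induced D') U (fun x => ι' x.1) ∧
      (∀ w ∈ D, ι' w = ι w) ∧ (∀ w ∈ D', ι' w ∈ E → w ∈ D) ∧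
      ∀ (s : σ.symbols) (t : Fin (σ.arity s) → U.carrier), t ∈ U.rel s →
        (∀ j, t j ∈ E ∨ t j ∈ ι' '' D') → (∀ j, t j ∈ E) ∨ ∀ j, t j ∈ ι' '' D' := by
  classical
  obtain ⟨F, g₁, g₂, hF, hg₁, hg₂, hcomm, -, hint, hrel⟩ := hfap (W.induced D) (U.induced E)
    (W.induced D') (hD'.of_isEmb (isEmb_inclusion W hDD')) (inAge_induced U hE) hD'
    (fun x => ⟨ι x.1, hιE _ x.2⟩) _
    ⟨fun x y h => hι.1 (congrArg Subtype.val h), hι.2⟩ (isEmb_inclusion W hDD')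
  obtain ⟨d, hd, hfix⟩ := hhom.exists_isEmb_fixing hF hg₁
  set ι' : W.carrier → U.carrier := fun w => if hw : w ∈ D' then d (g₂ ⟨w, hw⟩) else ι w
  have hι' : ∀ x : (W.induced D').carrier, ι' x.1 = d (g₂ x) := fun x => dif_pos x.2
  refine ⟨ι', ?_, fun w hw => ?_, fun w hw hwE => ?_, fun s t ht hmem => ?_⟩
  · rw [funext hι']
    exact hd.comp hg₂
  · rw [hι' ⟨w, hDD' hw⟩]
    exact (congrArg d (hcomm ⟨w, hw⟩)).symm.trans (hfix _)
  · have h₁ : d (g₁ ⟨ι' w, hwE⟩) = d (g₂ ⟨w, hw⟩) := (hfix _).trans (hι' ⟨w, hw⟩)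
    obtain ⟨a, -, ha⟩ := hint _ _ (hd.1 h₁)
    have : a.1 = w := congrArg Subtype.val ha
    exact this ▸ a.2
  · have hpre : ∀ j, ∃ y, d y = t j := by
      intro j
      rcases hmem j with h | ⟨w, hw, h⟩
      · exact ⟨_, hfix ⟨t j, h⟩⟩
      · exact ⟨_, (hι' ⟨w, hw⟩).symm.trans h⟩
    choose t₀ ht₀ using hpre
    obtain rfl : (fun j => d (t₀ j)) = t := funext ht₀
    rcases hrel s t₀ ((hd.2 s t₀).2 ht) with ⟨t', -, h⟩ | ⟨t', -, h⟩
    · refine Or.inl fun j => ?_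
      have : d (t₀ j) = (t' j).1 := (congrArg d (h j)).symm.trans (hfix _)
      exact Set.mem_of_eq_of_mem this (t' j).2
    · refine Or.inr fun j => ⟨(t' j).1, (t' j).2, ?_⟩
      exact (hι' _).trans (congrArg d (h j))

/-- The age of a structure with the free amalgamation property contains the free union of two
of its members, sitting inside an arbitrary structure `Y`. -/
theorem inAge_induced_union {σ : RelSig} {U Y : RelStr σ} (hfap : AgeFAP U)
    {B₁ B₂ : Set Y.carrier} (h₁ : inAge U (Y.induced B₁)) (h₂ : inAge U (Y.induced B₂))
    (hfree : ∀ (s : σ.symbols) (t : Fin (σ.arity s) → Y.carrier), t ∈ Y.rel s →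
      (∀ j, t j ∈ B₁ ∪ B₂) → (∀ j, t j ∈ B₁) ∨ ∀ j, t j ∈ B₂) :
    inAge U (Y.induced (B₁ ∪ B₂)) := by
  classical
  obtain ⟨F, g₁, g₂, hF, hg₁, hg₂, hcomm, -, hint, hrel⟩ := hfap (Y.induced (B₁ ∩ B₂))
    (Y.induced B₁) (Y.induced B₂) (h₁.of_isEmb (isEmb_inclusion Y Set.inter_subset_left)) h₁ h₂
    _ _ (isEmb_inclusion Y Set.inter_subset_left) (isEmb_inclusion Y Set.inter_subset_right)
  set m : (Y.induced (B₁ ∪ B₂)).carrier → F.carrier := fun y =>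
    if h : y.1 ∈ B₁ then g₁ ⟨y.1, h⟩ else g₂ ⟨y.1, y.2.resolve_left h⟩
  have hm₁ : ∀ (y : (Y.induced (B₁ ∪ B₂)).carrier) (h : y.1 ∈ B₁), m y = g₁ ⟨y.1, h⟩ :=
    fun y h => dif_pos h
  have hm₂ : ∀ (y : (Y.induced (B₁ ∪ B₂)).carrier) (h : y.1 ∈ B₂), m y = g₂ ⟨y.1, h⟩ := by
    intro y h
    by_cases h' : y.1 ∈ B₁
    · exact (hm₁ y h').trans (hcomm ⟨y.1, h', h⟩)
    · exact dif_neg h'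
  have hmix : ∀ (y z : (Y.induced (B₁ ∪ B₂)).carrier), y.1 ∈ B₁ → z.1 ∈ B₂ →
      m y = m z → y = z := by
    intro y z hy hz h
    rw [hm₁ y hy, hm₂ z hz] at h
    obtain ⟨a, ha₁, ha₂⟩ := hint _ _ h
    exact Subtype.ext ((congrArg Subtype.val ha₁).symm.trans (congrArg Subtype.val ha₂))
  have hinj : Function.Injective m := by
    intro y z h
    rcases y.2 with hy | hy <;> rcases z.2 with hz | hz
    · rw [hm₁ y hy, hm₁ z hz] at h
      exact Subtype.ext (Subtype.mk.inj (hg₁.1 h))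
    · exact hmix y z hy hz h
    · exact (hmix z y hz hy h.symm).symm
    · rw [hm₂ y hy, hm₂ z hz] at h
      exact Subtype.ext (Subtype.mk.inj (hg₂.1 h))
  refine hF.of_isEmb (g := m) ⟨hinj, fun s t => ⟨fun ht => ?_, fun ht => ?_⟩⟩
  · rcases hfree s _ ht (fun j => (t j).2) with h | h
    · have : (fun j => m (t j)) = fun j => g₁ ⟨(t j).1, h j⟩ := funext fun j => hm₁ _ (h j)
      rw [this]
      exact (hg₁.2 s fun j => ⟨(t j).1, h j⟩).1 ht
    · have : (fun j => m (t j)) = fun j => g₂ ⟨(t j).1, h j⟩ := funext fun j => hm₂ _ (h j)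
      rw [this]
      exact (hg₂.2 s fun j => ⟨(t j).1, h j⟩).1 ht
  · rcases hrel s _ ht with ⟨t', ht', h⟩ | ⟨t', ht', h⟩
    · obtain rfl : (fun j => ⟨(t' j).1, Or.inl (t' j).2⟩) = t :=
        funext fun j => hinj ((hm₁ _ (t' j).2).trans (h j))
      exact ht'
    · obtain rfl : (fun j => ⟨(t' j).1, Or.inr (t' j).2⟩) = t :=
        funext fun j => hinj ((hm₂ _ (t' j).2).trans (h j))
      exact ht'

/-! ### Extending all homomorphisms along one embedding -/

theorem exists_chain {α : Type} (P : ℕ → α → Prop) (R : ℕ → α → α → Prop) (h₀ : ∃ a, P 0 a)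
    (hs : ∀ n a, P n a → ∃ b, P (n + 1) b ∧ R n a b) :
    ∃ c : ℕ → α, (∀ n, P n (c n)) ∧ ∀ n, R n (c n) (c (n + 1)) := by
  choose! next hP hR using hs
  obtain ⟨a, ha⟩ := h₀
  let c : ℕ → α := fun n => Nat.rec a next n
  have hc : ∀ n, P n (c n) := by
    intro n
    induction n with
    | zero => exact ha
    | succ n ih => exact hP n _ ih
  exact ⟨c, hc, fun n => hR n _ (hc n)⟩

theorem exists_limit {α β : Type} {E : ℕ → Set α} (hE : Monotone E)
    (hcover : ∀ x, ∃ n, x ∈ E n) {g : ℕ → α → β}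
    (hg : ∀ n, ∀ x ∈ E n, g (n + 1) x = g n x) :
    ∃ G : α → β, ∀ n, ∀ x ∈ E n, G x = g n x := by
  have key : ∀ n m, n ≤ m → ∀ x ∈ E n, g m x = g n x := by
    intro n m hnm x hx
    induction m, hnm using Nat.le_induction with
    | base => rfl
    | succ m hnm ih => exact (hg m x (hE hnm hx)).trans ih
  choose N hN using hcover
  refine ⟨fun x => g (N x) x, fun n x hx => ?_⟩
  exact (key _ _ (le_max_left (N x) n) x (hN x)).symm.trans
    (key _ _ (le_max_right (N x) n) x hx)

theorem exists_common_stage {α : Type} {E : ℕ → Set α} (hE : Monotone E)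
    (hcover : ∀ x, ∃ n, x ∈ E n) {k : ℕ} (t : Fin k → α) : ∃ n, ∀ j, t j ∈ E n := by
  choose N hN using hcover
  exact ⟨Finset.univ.sup fun j => N (t j), fun j =>
    hE (Finset.le_sup (f := fun j => N (t j)) (Finset.mem_univ j)) (hN _)⟩

theorem IsHom.of_stages {σ : RelSig} {A B : RelStr σ} {E : ℕ → Set A.carrier} (hE : Monotone E)
    (hcover : ∀ x, ∃ n, x ∈ E n) {g : A.carrier → B.carrier}
    (hg : ∀ n, IsHom (A.induced (E n)) B (fun x => g x.1)) : IsHom A B g := by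
  intro s t ht
  obtain ⟨n, hn⟩ := exists_common_stage hE hcover t
  exact hg n s (fun j => ⟨t j, hn j⟩) ht

theorem IsEmb.of_stages {σ : RelSig} {A B : RelStr σ} {E : ℕ → Set A.carrier} (hE : Monotone E)
    (hcover : ∀ x, ∃ n, x ∈ E n) {g : A.carrier → B.carrier}
    (hg : ∀ n, IsEmb (A.induced (E n)) B (fun x => g x.1)) : IsEmb A B g := by
  refine ⟨fun x y h => ?_, fun s t => ?_⟩
  · obtain ⟨n, hn⟩ := exists_common_stage hE hcover ![x, y]
    exact congrArg Subtype.val ((hg n).1 (a₁ := ⟨x, hn 0⟩) (a₂ := ⟨y, hn 1⟩) h)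
  · obtain ⟨n, hn⟩ := exists_common_stage hE hcover t
    exact (hg n).2 s (fun j => ⟨t j, hn j⟩)

/-- A partial endomorphism prescribed on the image of a partial embedding extends along a free
extension of that embedding. -/
theorem exists_isHom_extension_of_free {σ : RelSig} {U W : RelStr σ} {E : Set U.carrier}
    {D D' : Set W.carrier} {ι ι' : W.carrier → U.carrier}
    (hι' : IsEmb (W.induced D') U (fun x => ι' x.1)) (hagree : ∀ w ∈ D, ι' w = ι w)
    (hdisj : ∀ w ∈ D', ι' w ∈ E → w ∈ D)
    (hfree : ∀ (s : σ.symbols) (t : Fin (σ.arity s) → U.carrier), t ∈ U.rel s →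
        (∀ j, t j ∈ E ∨ t j ∈ ι' '' D') → (∀ j, t j ∈ E) ∨ ∀ j, t j ∈ ι' '' D')
    {f : W.carrier → U.carrier} (hf : IsHom W U f) {e : U.carrier → U.carrier}
    (he : IsHom (U.induced E) U (fun x => e x.1)) (hef : ∀ w ∈ D, e (ι w) = f w) :
    ∃ e' : U.carrier → U.carrier, IsHom (U.induced (E ∪ ι' '' D')) U (fun x => e' x.1) ∧
      (∀ x ∈ E, e' x = e x) ∧ ∀ w ∈ D', e' (ι' w) = f w := by
  classical
  set e' : U.carrier → U.carrier := fun x =>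
    if x ∈ E then e x else if h : ∃ w ∈ D', ι' w = x then f h.choose else x
  have h₁ : ∀ x ∈ E, e' x = e x := fun x hx => if_pos hx
  have h₂ : ∀ w ∈ D', e' (ι' w) = f w := by
    intro w hw
    by_cases hE : ι' w ∈ E
    · have hD := hdisj w hw hE
      rw [h₁ _ hE, hagree w hD, hef w hD]
    · have hex : ∃ w₀ ∈ D', ι' w₀ = ι' w := ⟨w, hw, rfl⟩
      have : hex.choose = w := congrArg Subtype.val
        (hι'.1 (a₁ := ⟨_, hex.choose_spec.1⟩) (a₂ := ⟨w, hw⟩) hex.choose_spec.2)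
      simp only [e', if_neg hE, dif_pos hex, this]
  refine ⟨e', fun s t ht => ?_, h₁, h₂⟩
  rcases hfree s _ ht (fun j => (t j).2) with h | h
  · have : (fun j => e' (t j).1) = fun j => e (t j).1 := funext fun j => h₁ _ (h j)
    rw [this]
    exact he s (fun j => ⟨(t j).1, h j⟩) ht
  · choose w hw hwt using h
    have : (fun j => e' (t j).1) = fun j => f (w j) :=
      funext fun j => by rw [← hwt j, h₂ _ (hw j)]
    rw [this]
    refine hf s w ((hι'.2 s fun j => ⟨w j, hw j⟩).2 ?_)
    rw [funext hwt]
    exact ht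

/-- Every countable structure younger than `U` embeds into `U` in such a way that all its
homomorphisms to `U` extend to endomorphisms of `U`. -/
theorem exists_isEmb_forall_isHom_extends {σ : RelSig} {U W : RelStr σ}
    (hU : Countable U.carrier) (hW : Countable W.carrier) (hhom : IsHomogeneous U)
    (hfap : AgeFAP U) (hhap : AgeHAP U)
    (hage : ∀ F : Set W.carrier, F.Finite → inAge U (W.induced F)) :
    ∃ ι : W.carrier → U.carrier, IsEmb W U ι ∧ ∀ f : W.carrier → U.carrier, IsHom W U f →
      ∃ e : U.carrier → U.carrier, IsHom U U e ∧ ∀ w, e (ι w) = f w := by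
  obtain ⟨encU, hencU⟩ := hU
  obtain ⟨encW, hencW⟩ := hW
  let D : ℕ → Set W.carrier := fun n => {w | encW w < n}
  have hDfin : ∀ n, (D n).Finite := fun n => (Set.finite_Iio n).preimage hencW.injOn
  have hUfin : ∀ n, {u | encU u < n}.Finite := fun n => (Set.finite_Iio n).preimage hencU.injOn
  have hDmono : Monotone D := fun m n hmn w (hw : encW w < m) => lt_of_lt_of_le hw hmn
  have hDcover : ∀ w, ∃ n, w ∈ D n := fun w => ⟨encW w + 1, Nat.lt_succ_self _⟩
  obtain ⟨c, hP, hR⟩ := exists_chain (α := Set U.carrier × (W.carrier → U.carrier))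
    (fun n a => a.1.Finite ∧ (∀ u, encU u < n → u ∈ a.1) ∧
      IsEmb (W.induced (D n)) U (fun x => a.2 x.1) ∧ ∀ w ∈ D n, a.2 w ∈ a.1)
    (fun n a b => a.1 ∪ b.2 '' D (n + 1) ⊆ b.1 ∧ (∀ w ∈ D n, b.2 w = a.2 w) ∧
      (∀ w ∈ D (n + 1), b.2 w ∈ a.1 → w ∈ D n) ∧
      ∀ (s : σ.symbols) (t : Fin (σ.arity s) → U.carrier), t ∈ U.rel s →
        (∀ j, t j ∈ a.1 ∨ t j ∈ b.2 '' D (n + 1)) →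
          (∀ j, t j ∈ a.1) ∨ ∀ j, t j ∈ b.2 '' D (n + 1))
    (by
      choose m hm using fun F hF => (hage F hF).2
      refine ⟨(∅, fun w => m {w} (Set.finite_singleton w) ⟨w, rfl⟩), Set.finite_empty,
        fun u hu => absurd hu (Nat.not_lt_zero _), ?_, fun w hw => absurd hw (Nat.not_lt_zero _)⟩
      convert hm (D 0) (hDfin 0) using 1
      exact funext fun x => absurd x.2 (Nat.not_lt_zero _))
    (by
      rintro n ⟨E, ι⟩ ⟨hE, hEn, hι, hιE⟩
      obtain ⟨ι', hι', h₁, h₂, h₃⟩ := exists_free_isEmb_extension hhom hfap hE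
        (hDmono n.le_succ) (hage _ (hDfin (n + 1))) hι hιE
      refine ⟨(E ∪ ι' '' D (n + 1) ∪ {u | encU u < n + 1}, ι'),
        ⟨(hE.union ((hDfin _).image _)).union (hUfin _), fun u hu => Or.inr hu, hι',
          fun w hw => Or.inl (Or.inr ⟨w, hw, rfl⟩)⟩, Set.subset_union_left, h₁, h₂, h₃⟩)
  have hEmono : Monotone fun n => (c n).1 :=
    monotone_nat_of_le_succ fun n => Set.subset_union_left.trans (hR n).1
  have hEcover : ∀ u, ∃ n, u ∈ (c n).1 :=
    fun u => ⟨encU u + 1, (hP _).2.1 u (Nat.lt_succ_self _)⟩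
  obtain ⟨ι, hι⟩ := exists_limit hDmono hDcover (g := fun n => (c n).2) fun n => (hR n).2.1
  refine ⟨ι, IsEmb.of_stages hDmono hDcover fun n => ?_, fun f hf => ?_⟩
  · have : (fun x : (W.induced (D n)).carrier => ι x.1) = fun x => (c n).2 x.1 :=
      funext fun x => hι n _ x.2
    rw [this]
    exact (hP n).2.2.1
  · obtain ⟨e, he, hee⟩ := exists_chain (α := U.carrier → U.carrier)
      (fun n e => IsHom (U.induced (c n).1) U (fun x => e x.1) ∧ ∀ w ∈ D n, e ((c n).2 w) = f w)
      (fun n e e' => ∀ x ∈ (c n).1, e' x = e x)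
      ⟨id, (isEmb_induced_val U _).isHom, fun w hw => absurd hw (Nat.not_lt_zero _)⟩
      (by
        rintro n e ⟨he, hef⟩
        obtain ⟨e₁, he₁, h₁, h₂⟩ := exists_isHom_extension_of_free (hP (n + 1)).2.2.1
          (hR n).2.1 (hR n).2.2.1 (hR n).2.2.2 hf he hef
        obtain ⟨e₂, he₂, h₃⟩ := exists_isHom_extension hhom hhap (hP (n + 1)).1 (hR n).1 he₁
        exact ⟨e₂, ⟨he₂, fun w hw => (h₃ _ (Or.inr ⟨w, hw, rfl⟩)).trans (h₂ w hw)⟩,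
          fun x hx => (h₃ x (Or.inl hx)).trans (h₁ x hx)⟩)
    obtain ⟨g, hg⟩ := exists_limit hEmono hEcover hee
    refine ⟨g, IsHom.of_stages hEmono hEcover fun n => ?_, fun w => ?_⟩
    · have : (fun x : (U.induced (c n).1).carrier => g x.1) = fun x => e n x.1 :=
        funext fun x => hg n _ x.2
      rw [this]
      exact (he n).1
    · obtain ⟨n, hn⟩ := hDcover w
      rw [hι n w hn, hg n _ ((hP n).2.2.2 w hn), (he n).2 w hn]

/-! ### Powers -/

theorem inAge_pow {σ : RelSig} {U A : RelStr σ} (hprod : AgeClosedUnderProducts U)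
    (hA : inAge U A) (n : ℕ) : inAge U (A.pow (n + 1)) := by
  induction n with
  | zero =>
    refine hA.of_isEmb (g := fun x : Fin 1 → A.carrier => x 0)
      ⟨fun x y h => funext fun i => ?_, fun s t => ⟨fun h => h 0, fun h i => ?_⟩⟩
    · rw [Fin.fin_one_eq_zero i]
      exact h
    · rw [Fin.fin_one_eq_zero i]
      exact h
  | succ n ih =>
    refine (hprod _ _ hA ih).of_isEmb
      (g := fun x : Fin (n + 2) → A.carrier => ((x 0, fun i => x i.succ) : A.carrier × _))
      ⟨fun x y h => funext fun i => ?_, fun s t => ⟨fun h => ⟨h 0, fun i => h i.succ⟩,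
        fun h i => ?_⟩⟩
    · refine Fin.cases ?_ (fun i => ?_) i
      · exact congrArg Prod.fst h
      · exact congrFun (congrArg Prod.snd h) i
    · exact Fin.cases h.1 h.2 i

theorem inAge_induced_pow {σ : RelSig} {U : RelStr σ} (hprod : AgeClosedUnderProducts U) (n : ℕ)
    {F : Set (U.pow (n + 1)).carrier} (hF : F.Finite) :
    inAge U ((U.pow (n + 1)).induced F) := by
  let S : Set U.carrier := ⋃ i : Fin (n + 1), (fun x : Fin (n + 1) → U.carrier => x i) '' F
  have hS : S.Finite := Set.finite_iUnion fun i => hF.image _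
  refine (inAge_pow hprod (inAge_induced U hS) n).of_isEmb
    (g := fun x i => ⟨x.1 i, Set.mem_iUnion.2 ⟨i, x.1, x.2, rfl⟩⟩)
    ⟨fun x y h => Subtype.ext (funext fun i => ?_), fun s t => Iff.rfl⟩
  exact congrArg Subtype.val (congrFun h i)

/-! ### The tree of copies of a structure -/

/-- Continuum many copies of `X`, indexed by binary sequences and freely glued: two copies share
the points whose code is at most the first place where the sequences differ. -/
def tree {σ : RelSig} (X : RelStr σ) (enc : X.carrier → ℕ) : RelStr σ where
  carrier := Σ x : X.carrier, (Fin (enc x) → Bool)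
  rel s := {t | (∃ b : ℕ → Bool, ∀ j, (t j).2 = fun i : Fin (enc (t j).1) => b i) ∧ (fun j => (t j).1) ∈ X.rel s}

/-- The copy of `X` in its tree along the binary sequence `b`. -/
def branch {σ : RelSig} (X : RelStr σ) (enc : X.carrier → ℕ) (b : ℕ → Bool) :
    X.carrier → (X.tree enc).carrier :=
  fun x => ⟨x, fun i : Fin (enc x) => b i⟩

theorem isHom_branch {σ : RelSig} (X : RelStr σ) (enc : X.carrier → ℕ) (b : ℕ → Bool) :
    IsHom X (X.tree enc) (X.branch enc b) :=
  fun _ _ ht => ⟨⟨b, fun _ => rfl⟩, ht⟩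

theorem inAge_induced_of_branch {σ : RelSig} {U X : RelStr σ} {enc : X.carrier → ℕ}
    (hX : ∀ F : Set X.carrier, F.Finite → inAge U (X.induced F))
    {F : Set (X.tree enc).carrier} (hF : F.Finite) {b : ℕ → Bool}
    (hb : ∀ w ∈ F, w = X.branch enc b w.1) : inAge U ((X.tree enc).induced F) := by
  let π : ((X.tree enc).induced F).carrier → (X.induced (Sigma.fst '' F)).carrier :=
    fun w => ⟨w.1.1, Set.mem_image_of_mem Sigma.fst w.2⟩
  refine (hX _ (hF.image Sigma.fst)).of_isEmb (g := π)
    ⟨fun x y h => Subtype.ext ?_, fun s t => ⟨fun h => h.2, fun h => ⟨⟨b, fun j => ?_⟩, h⟩⟩⟩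
  · rw [hb _ x.2, hb _ y.2]
    exact congrArg _ (congrArg Subtype.val h)
  · have key : ∀ w : (X.tree enc).carrier, w ∈ F → w.2 = fun i : Fin (enc w.1) => b i := by
      intro w hw
      rw [hb w hw]
      rfl
    exact key _ (t j).2

theorem inAge_induced_tree {σ : RelSig} {U X : RelStr σ} (hfap : AgeFAP U)
    (hX : ∀ F : Set X.carrier, F.Finite → inAge U (X.induced F)) (enc : X.carrier → ℕ)
    {F : Set (X.tree enc).carrier} (hF : F.Finite) : inAge U ((X.tree enc).induced F) := by
  classical
  lift F to Finset (X.tree enc).carrier using hF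
  induction F using Finset.induction_on_max_value (fun w : (X.tree enc).carrier => enc w.1) with
  | empty => exact inAge_induced_of_branch hX (Finset.finite_toSet _) (b := fun _ => false) (by simp)
  | insert w F hw hmax ih =>
    let b : ℕ → Bool := fun i => if h : i < enc w.1 then w.2 ⟨i, h⟩ else false
    have hb : w.2 = fun i : Fin (enc w.1) => b i := by
      funext i
      simp only [b, dif_pos i.2]
    have hbw : w = X.branch enc b w.1 := Sigma.ext rfl (heq_of_eq hb)
    let B : Set (X.tree enc).carrier := {y ∈ insert w (F : Set _) | y = X.branch enc b y.1}
    have hBfin : B.Finite := (F.finite_toSet.insert w).subset (Set.sep_subset _ _)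
    have hunion : ((insert w F : Finset _) : Set (X.tree enc).carrier) = ↑F ∪ B := by
      ext y
      simp only [Finset.coe_insert, Set.mem_insert_iff, Set.mem_union, B, Set.mem_ofPred_eq]
      constructor
      · rintro (rfl | h)
        · exact Or.inr ⟨Or.inl rfl, hbw⟩
        · exact Or.inl h
      · rintro (h | h)
        · exact Or.inr h
        · exact h.1
    rw [hunion]
    refine inAge_induced_union hfap ih
      (inAge_induced_of_branch hX hBfin fun y hy => hy.2) fun s t ht hmem => ?_
    by_cases hwt : ∃ j, t j = w
    · obtain ⟨j₀, hj₀⟩ := hwt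
      obtain ⟨b', hb'⟩ := ht.1
      refine Or.inr fun j => ?_
      have hj : t j ∈ insert w (F : Set (X.tree enc).carrier) := by
        have := hmem j
        rwa [← hunion, Finset.coe_insert] at this
      have hle : enc (t j).1 ≤ enc w.1 := by
        rcases hj with h | h
        · rw [h]
        · exact hmax _ h
      refine ⟨hj, Sigma.ext rfl (heq_of_eq ((hb' j).trans (funext fun i => ?_)))⟩
      have hi : (i : ℕ) < enc w.1 := lt_of_lt_of_le i.2 hle
      have hwb : w.2 = fun i : Fin (enc w.1) => b' i := hj₀ ▸ hb' j₀
      have hbi : b i = w.2 ⟨i, hi⟩ := dif_pos hi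
      exact (hbi.trans (congrFun hwb _)).symm
    · refine Or.inl fun j => (hmem j).elim id fun h => h.1.resolve_left fun h' => hwt ⟨j, h'⟩

/-- Two homomorphisms that agree on the points of small code can be prescribed simultaneously
on two different branches of the tree. -/
theorem exists_isHom_tree {σ : RelSig} {U X : RelStr σ} {enc : X.carrier → ℕ} {b b' : ℕ → Bool}
    {n : ℕ} (hn : b n ≠ b' n) {f f' : X.carrier → U.carrier} (hf : IsHom X U f)
    (hf' : IsHom X U f') (hagree : ∀ x, enc x ≤ n → f x = f' x) :
    ∃ p : (X.tree enc).carrier → U.carrier, IsHom (X.tree enc) U p ∧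
      (∀ x, p (X.branch enc b x) = f x) ∧ ∀ x, p (X.branch enc b' x) = f' x := by
  classical
  let p : (X.tree enc).carrier → U.carrier := fun w =>
    if ∃ h : n < enc w.1, w.2 ⟨n, h⟩ = b' n then f' w.1 else f w.1
  have h₁ : ∀ a : ℕ → Bool, a n = b' n → ∀ x, p (X.branch enc a x) = f' x := by
    intro a ha x
    by_cases h : n < enc x
    · exact if_pos ⟨h, ha⟩
    · exact (if_neg fun h' => h h'.1).trans (hagree x (not_lt.1 h))
  have h₂ : ∀ a : ℕ → Bool, a n ≠ b' n → ∀ x, p (X.branch enc a x) = f x :=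
    fun a ha x => if_neg fun h => ha h.2
  refine ⟨p, fun s t ht => ?_, h₂ b hn, h₁ b' rfl⟩
  obtain ⟨⟨a, ha⟩, ht⟩ := ht
  have hta : ∀ j, t j = X.branch enc a (t j).1 := fun j => Sigma.ext rfl (heq_of_eq (ha j))
  by_cases h : a n = b' n
  · have : (fun j => p (t j)) = fun j => f' (t j).1 := funext fun j => by
      rw [hta j, h₁ a h]
      rfl
    rw [this]
    exact hf' s _ ht
  · have : (fun j => p (t j)) = fun j => f (t j).1 := funext fun j => by
      rw [hta j, h₂ a h]
      rfl
    rw [this]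
    exact hf s _ ht

end RelStr

/-! ### Clone homomorphisms -/

/-- Each value of the image of an operation under a clone homomorphism from `Pol(U)` is
determined by finitely many values of the operation. -/
theorem CloneHom.exists_finite_determining {σ : RelSig} {U : RelStr σ} {V : Type}
    (hU : Countable U.carrier) (hV : Countable V) (hhom : RelStr.IsHomogeneous U)
    (hfap : RelStr.AgeFAP U) (hprod : RelStr.AgeClosedUnderProducts U) (hhap : RelStr.AgeHAP U)
    {C : Clone V} (h : CloneHom (polClone U) C) (n : ℕ) (v : Fin (n + 1) → V) :
    ∃ G : Set (Fin (n + 1) → U.carrier), G.Finite ∧ ∀ f f' : (polClone U).ops n,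
      (∀ x ∈ G, f.val x = f'.val x) → (h.app n f).val v = (h.app n f').val v := by
  let X := U.pow (n + 1)
  obtain ⟨enc, henc⟩ : Countable X.carrier := inferInstanceAs (Countable (Fin (n + 1) → U.carrier))
  have hX : ∀ F : Set X.carrier, F.Finite → RelStr.inAge U (X.induced F) :=
    fun F hF => RelStr.inAge_induced_pow hprod n hF
  have hT : Countable (X.tree enc).carrier := by
    have : Countable X.carrier := ⟨enc, henc⟩
    exact inferInstanceAs (Countable (Σ x : X.carrier, (Fin (enc x) → Bool)))
  obtain ⟨ι, hι, hext⟩ := RelStr.exists_isEmb_forall_isHom_extends hU hT hhom hfap hhap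
    fun F hF => RelStr.inAge_induced_tree hfap hX enc hF
  let T : (ℕ → Bool) → (polClone U).ops n := fun b =>
    ⟨fun x => ι (X.branch enc b x), hι.isHom.comp (X.isHom_branch enc b)⟩
  obtain ⟨b, b', hbb', hne⟩ : ∃ b b', (h.app n (T b)).val v = (h.app n (T b')).val v ∧ b ≠ b' := by
    have hni : ¬ Function.Injective fun b => (h.app n (T b)).val v := fun hinj => by
      classical
      obtain ⟨g, hg⟩ := hinj.countable
      refine Function.cantor_injective (fun A : Set ℕ => g fun i => decide (i ∈ A))
        fun A B hAB => Set.ext fun i => ?_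
      simpa using congrFun (hg hAB) i
    simpa [Function.Injective] using hni
  obtain ⟨m, hm⟩ := Function.ne_iff.1 hne
  refine ⟨{x | enc x ≤ m}, (Set.finite_Iic m).preimage henc.injOn, fun f f' hff' => ?_⟩
  obtain ⟨p, hp, hpb, hpb'⟩ := RelStr.exists_isHom_tree hm f.2 f'.2 hff'
  obtain ⟨e, he, hep⟩ := hext p hp
  let P : (polClone U).ops 0 := ⟨fun x => e (x 0), fun s t ht => he s _ (ht 0)⟩
  have key : ∀ (a : ℕ → Bool) (g : (polClone U).ops n), (∀ x, p (X.branch enc a x) = g.val x) →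
      (h.app n g).val v = (h.app 0 P).val fun _ => (h.app n (T a)).val v := by
    intro a g hg
    rw [← congrFun (h.map_comp 0 n P fun _ => T a) v]
    have hgP : g.val = fun x => P.val fun _ => (T a).val x :=
      funext fun x => ((hep _).trans (hg x)).symm
    exact congrArg (fun f => (h.app n f).val v) (Subtype.ext hgP)
  rw [key b f hpb, key b' f' hpb', hbb']

/-- If a clone contains the constants then the values of an operation are determined by those of
its image under an injective clone homomorphism. -/
theorem CloneHom.exists_finite_reflecting {U V : Type} {C : Clone U} {D : Clone V}
    (hconst : ∀ c : U, (fun _ : Fin 1 → U => c) ∈ C.ops 0)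
    (h : CloneHom C D) (hinj : ∀ n, Function.Injective (h.app n)) (n : ℕ) (u : Fin (n + 1) → U) :
    ∃ G : Set (Fin (n + 1) → V), G.Finite ∧ ∀ f f' : C.ops n,
      (∀ x ∈ G, (h.app n f).val x = (h.app n f').val x) → f.val u = f'.val u := by
  rcases isEmpty_or_nonempty V with hV | ⟨⟨v₀⟩⟩
  · refine ⟨∅, Set.finite_empty, fun f f' _ => ?_⟩
    rw [hinj n (Subtype.ext (funext fun x => isEmptyElim (x 0)) : h.app n f = h.app n f')]
  let k : U → C.ops 0 := fun c => ⟨fun _ => c, hconst c⟩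
  have hk : ∀ c (x y : Fin 1 → V), (h.app 0 (k c)).val x = (h.app 0 (k c)).val y := by
    intro c x y
    have h₀ := h.map_comp 0 1 (k c) fun _ => ⟨_, C.proj_mem 1 0⟩
    have h₁ := h.map_comp 0 1 (k c) fun _ => ⟨_, C.proj_mem 1 1⟩
    have := congrFun (h₀.symm.trans h₁) ![x 0, y 0]
    simp only [h.map_proj] at this
    convert this using 2 <;> (funext i; rw [Subsingleton.elim i 0]; rfl)
  let θ : U → V := fun c => (h.app 0 (k c)).val fun _ => v₀
  have hθ : Function.Injective θ := by
    intro c c' hcc'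
    have : k c = k c' := hinj 0 (Subtype.ext (funext fun x =>
      (hk c x _).trans (hcc'.trans (hk c' _ x))))
    exact congrFun (congrArg Subtype.val this) fun _ => c
  have hval : ∀ f : C.ops n, θ (f.val u) = (h.app n f).val fun i => θ (u i) :=
    fun f => congrFun (h.map_comp n 0 f fun i => k (u i)) fun _ => v₀
  refine ⟨{fun i => θ (u i)}, Set.finite_singleton _, fun f f' hff' => hθ ?_⟩
  rw [hval, hval, hff' _ rfl]

/-- A map between sets of functions with discrete codomains is continuous for the topologies of
pointwise convergence if each value of the image is determined by finitely many values. -/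
theorem continuous_of_finite_determining {α β α' β' : Type} [TopologicalSpace β]
    [DiscreteTopology β] [TopologicalSpace β'] {S : Set (α → β)} {S' : Set (α' → β')}
    {φ : S → S'} (hφ : ∀ v : α', ∃ G : Set α, G.Finite ∧ ∀ f f' : S,
      (∀ x ∈ G, f.val x = f'.val x) → (φ f).val v = (φ f').val v) : Continuous φ := by
  refine Continuous.subtype_mk (f := fun f => (φ f).val) (continuous_pi fun v => ?_) _
  obtain ⟨G, hG, h⟩ := hφ v
  refine IsLocallyConstant.continuous ((IsLocallyConstant.iff_exists_open _).2 fun f => ?_)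
  refine ⟨⋂ x ∈ G, {f' : S | f'.val x = f.val x}, ?_, Set.mem_iInter₂.2 fun _ _ => rfl,
    fun f' hf' => h _ _ fun x hx => Set.mem_iInter₂.1 hf' x hx⟩
  exact hG.isOpen_biInter fun x _ => (isOpen_discrete ({f.val x} : Set β)).preimage
    ((continuous_apply (A := fun _ : α => β) x).comp continuous_subtype_val)

theorem CloneHom.isHomeomorph_elemMap {U V : Type} {C : Clone U} {D : Clone V}
    (h : CloneHom C D) (hbij : ∀ n, Function.Bijective (h.app n))
    (hdet : ∀ (n : ℕ) (v : Fin (n + 1) → V), ∃ G : Set (Fin (n + 1) → U), G.Finite ∧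
      ∀ f f' : C.ops n, (∀ x ∈ G, f.val x = f'.val x) → (h.app n f).val v = (h.app n f').val v)
    (hrefl : ∀ (n : ℕ) (u : Fin (n + 1) → U), ∃ G : Set (Fin (n + 1) → V), G.Finite ∧
      ∀ f f' : C.ops n, (∀ x ∈ G, (h.app n f).val x = (h.app n f').val x) →
        f.val u = f'.val u) :
    @IsHomeomorph _ _ (cloneTop C) (cloneTop D) h.elemMap := by
  let _ : TopologicalSpace U := ⊥
  let _ : TopologicalSpace V := ⊥
  have : DiscreteTopology U := ⟨rfl⟩
  have : DiscreteTopology V := ⟨rfl⟩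
  let e : ∀ n, C.ops n ≃ D.ops n := fun n => Equiv.ofBijective _ (hbij n)
  let H : ∀ n, C.ops n ≃ₜ D.ops n := fun n =>
    { toEquiv := e n
      continuous_toFun := continuous_of_finite_determining (hdet n)
      continuous_invFun := continuous_of_finite_determining fun u => by
        obtain ⟨G, hG, hGu⟩ := hrefl n u
        refine ⟨G, hG, fun g g' hgg' => hGu _ _ fun x hx => ?_⟩
        have h₁ : h.app n ((e n).symm g) = g := (e n).apply_symm_apply g
        have h₂ : h.app n ((e n).symm g') = g' := (e n).apply_symm_apply g'
        exact (congrArg (fun f => f.val x) h₁).trans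
          ((hgg' x hx).trans (congrArg (fun f => f.val x) h₂).symm) }
  refine ⟨continuous_sigma fun n => continuous_sigmaMk.comp (H n).continuous,
    isOpenMap_sigma.2 fun n => isOpenMap_sigmaMk.comp (H n).isOpenMap, ?_⟩
  exact (Equiv.sigmaCongrRight e).bijective

/-- Let `U` be a countable homogeneous relational structure such that
`Pol(U)` contains all constant functions, `Age(U)` has the free amalgamation property,
is closed with respect to finite products, and has the homo-amalgamation property.
Then `Pol(U)` has automatic homeomorphicity: every clone isomorphism from `Pol(U)` to the
polymorphism clone of any countable relational structure is a homeomorphism. -/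
theorem stmt_18 {σ : RelSig} (U : RelStr σ)
    (hc : Countable U.carrier)
    (hhom : RelStr.IsHomogeneous U)
    (hconst : ∀ (n : ℕ) (c : U.carrier),
      (fun _ : Fin (n + 1) → U.carrier => c) ∈ (polClone U).ops n)
    (hfap : RelStr.AgeFAP U)
    (hprod : RelStr.AgeClosedUnderProducts U)
    (hhap : RelStr.AgeHAP U) :
    ∀ (τ : RelSig) (V : RelStr τ), Countable V.carrier →
      ∀ h : CloneHom (polClone U) (polClone V), (∀ n : ℕ, Function.Bijective (h.app n)) →
        @IsHomeomorph _ _ (cloneTop (polClone U)) (cloneTop (polClone V)) h.elemMap := by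
  intro τ V hV h hbij
  exact h.isHomeomorph_elemMap hbij
    (h.exists_finite_determining hc hV hhom hfap hprod hhap)
    (h.exists_finite_reflecting (hconst 0) fun n => (hbij n).1)
end

section
/- The polymorphism clone of the generic poset (ℙ, ≤) has automatic homeomorphicity: every clone isomorphism from Pol(ℙ, ≤) to the polymorphism clone of any countable relational structure is a homeomorphism with respect to the topologies of pointwise convergence. -/
set_option autoImplicit false

open RelStr

/-! ## One-point extensions and interpolation in the generic poset -/

/-- Every consistent one-point order type over a finite subset of `P` is realised in `P`. -/
def OnePointExtension (P : Type) [PartialOrder P] : Prop :=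
  ∀ S D U : Set P, S.Finite →
    (∀ a ∈ S, ∀ b ∈ S, a ≤ b → b ∈ D → a ∈ D) →
    (∀ a ∈ S, ∀ b ∈ S, a ≤ b → a ∈ U → b ∈ U) →
    (∀ a ∈ S, ∀ b ∈ S, a ∈ D → b ∈ U → a < b) →
    ∃ z : P, ∀ s ∈ S, (s ≤ z ↔ s ∈ D) ∧ (z ≤ s ↔ s ∈ U)

/-- The type `S` together with one additional point. -/
inductive AddPoint (S : Type)
  | old (s : S)
  | new

instance {S : Type} [Finite S] : Finite (AddPoint S) :=
  Finite.of_surjective (fun o : Option S => o.elim AddPoint.new AddPoint.old) fun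
    | .old s => ⟨some s, rfl⟩
    | .new => ⟨none, rfl⟩

/-- The order on `AddPoint S` in which the new point lies above `D` and below `U`. -/
abbrev onePointOrder {P : Type} [PartialOrder P] (S D U : Set P)
    (hD : ∀ a ∈ S, ∀ b ∈ S, a ≤ b → b ∈ D → a ∈ D)
    (hU : ∀ a ∈ S, ∀ b ∈ S, a ≤ b → a ∈ U → b ∈ U)
    (hDU : ∀ a ∈ S, ∀ b ∈ S, a ∈ D → b ∈ U → a < b) : PartialOrder (AddPoint S) where
  le
    | .old a, .old b => a.1 ≤ b.1
    | .old a, .new => a.1 ∈ D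
    | .new, .old b => b.1 ∈ U
    | .new, .new => True
  le_refl a := by
    cases a with
    | new => trivial
    | old a => exact le_refl a.1
  le_trans a b c hab hbc := by
    rcases a with a | _ <;> rcases b with b | _ <;> rcases c with c | _
    · exact le_trans (α := P) hab hbc
    · exact hD _ a.2 _ b.2 hab hbc
    · exact (hDU _ a.2 _ c.2 hab hbc).le
    · exact hab
    · exact hU _ b.2 _ c.2 hbc hab
    · trivial
    · exact hbc
    · trivial
  le_antisymm a b hab hba := by
    rcases a with a | _ <;> rcases b with b | _
    · exact congrArg AddPoint.old (Subtype.ext (le_antisymm (α := P) hab hba))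
    · exact absurd (hDU _ a.2 _ a.2 hab hba) (lt_irrefl _)
    · exact absurd (hDU _ b.2 _ b.2 hba hab) (lt_irrefl _)
    · rfl

theorem isEmb_ordStruc_iff_s19 {P Q : Type} [PartialOrder P] [PartialOrder Q] (f : P → Q) :
    IsEmb (ordStruc P) (ordStruc Q) f ↔ ∀ a b, f a ≤ f b ↔ a ≤ b := by
  constructor
  · intro h a b
    exact (h.2 () ![a, b]).symm
  · intro h
    refine ⟨fun (a b : P) (hab : f a = f b) =>
      le_antisymm (α := P) ((h a b).1 hab.le) ((h b a).1 hab.ge), fun s t => ?_⟩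
    exact (h (t (0 : Fin 2)) (t (1 : Fin 2))).symm

theorem isPolymorphism_ordStruc_iff {P : Type} [PartialOrder P] {n : ℕ}
    (f : (Fin n → P) → P) : IsPolymorphism (ordStruc P) n f ↔ Monotone f := by
  constructor
  · intro h a b hab
    exact h () ![a, b] hab
  · intro h s t ht
    exact h (a := t (0 : Fin 2)) (b := t (1 : Fin 2)) fun i => ht i

theorem onePointExtension_of_homogeneous (P : Type) [PartialOrder P]
    (hhom : IsHomogeneous (ordStruc P))
    (hage : ∀ (Q : Type) [PartialOrder Q] [Finite Q],
      ∃ ι : Q → P, ∀ a b : Q, ι a ≤ ι b ↔ a ≤ b) : OnePointExtension P := by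
  intro S D U hS hD hU hDU
  have : Finite S := hS
  let _ := onePointOrder S D U hD hU hDU
  obtain ⟨ι, hι⟩ := hage (AddPoint S)
  have hval : IsEmb (ordStruc S) (ordStruc P) Subtype.val :=
    (isEmb_ordStruc_iff_s19 _).2 fun _ _ => Iff.rfl
  have hsome : IsEmb (ordStruc S) (ordStruc P) (fun s => ι (AddPoint.old s)) :=
    (isEmb_ordStruc_iff_s19 _).2 fun (a b : S) => hι (AddPoint.old a) (AddPoint.old b)
  obtain ⟨h, ⟨-, hemb⟩, hh⟩ := hhom (ordStruc S) ⟨this, _, hval⟩ _ _ hsome hval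
  have hle := (isEmb_ordStruc_iff_s19 (P := P) (Q := P) h).1 hemb
  refine ⟨h (ι AddPoint.new), fun s hs => ?_⟩
  have hs' : h (ι (AddPoint.old ⟨s, hs⟩)) = s := hh ⟨s, hs⟩
  constructor
  · have h1 := (hle (ι (AddPoint.old ⟨s, hs⟩)) (ι AddPoint.new)).trans (hι (AddPoint.old ⟨s, hs⟩) .new)
    rw [hs'] at h1
    exact h1
  · have h1 := (hle (ι AddPoint.new) (ι (AddPoint.old ⟨s, hs⟩))).trans (hι AddPoint.new (AddPoint.old ⟨s, hs⟩))
    rw [hs'] at h1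
    exact h1

theorem OnePointExtension.exists_between {P : Type} [PartialOrder P] (hP : OnePointExtension P)
    {L U : Set P} (hL : L.Finite) (hU : U.Finite) (hLU : ∀ l ∈ L, ∀ u ∈ U, l ≤ u) :
    ∃ z, (∀ l ∈ L, l ≤ z) ∧ ∀ u ∈ U, z ≤ u := by
  by_cases hne : ∃ l ∈ L, l ∈ U
  · obtain ⟨z, hzL, hzU⟩ := hne
    exact ⟨z, fun l hl => hLU l hl z hzU, fun u hu => hLU z hzL u hu⟩
  · push Not at hne
    obtain ⟨z, hz⟩ := hP (L ∪ U) {s | ∃ l ∈ L, s ≤ l} {s | ∃ u ∈ U, u ≤ s} (hL.union hU)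
      (fun a _ b _ hab ⟨l, hl, hbl⟩ => ⟨l, hl, hab.trans hbl⟩)
      (fun a _ b _ hab ⟨u, hu, hua⟩ => ⟨u, hu, hua.trans hab⟩)
      (fun a _ b _ ⟨l, hl, hal⟩ ⟨u, hu, hub⟩ => hal.trans_lt
        (((hLU l hl u hu).lt_of_ne fun e => hne l hl (e ▸ hu)).trans_le hub))
    exact ⟨z, fun l hl => (hz l (Or.inl hl)).1.2 ⟨l, hl, le_rfl⟩,
      fun u hu => (hz u (Or.inr hu)).2.2 ⟨u, hu, le_rfl⟩⟩

/-! ## Limits of stepwise constructions -/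

/-- A chain of partial functions, whose `m`-th step puts `a m` into the domain, has a limit. -/
theorem exists_limit_of_steps {A B : Type} (a : ℕ → A) (ha : Function.Surjective a)
    (Good : Set A → (A → B) → Prop) (Step : ℕ → Set A → Set A → (A → B) → Prop)
    (S₀ : Set A) (f₀ : A → B) (h₀ : Good S₀ f₀)
    (step : ∀ m S f, Good S f → ∃ S' f', Good S' f' ∧ S ⊆ S' ∧ a m ∈ S' ∧
      Set.EqOn f' f S ∧ Step m S S' f') :
    ∃ (S : ℕ → Set A) (F : ℕ → A → B) (g : A → B), S 0 = S₀ ∧ F 0 = f₀ ∧ Monotone S ∧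
      (∀ x, ∃ m, x ∈ S m) ∧ (∀ m, Good (S m) (F m)) ∧ (∀ m, Set.EqOn (F m) g (S m)) ∧
      ∀ m, Step m (S m) (S (m + 1)) (F (m + 1)) := by
  choose! N G hN using step
  let st : ℕ → Set A × (A → B) :=
    fun k => Nat.rec (S₀, f₀) (fun m p => (N m p.1 p.2, G m p.1 p.2)) k
  have good : ∀ m, Good (st m).1 (st m).2 := by
    intro m
    induction m with
    | zero => exact h₀
    | succ m ih => exact (hN m _ _ ih).1
  have mono : Monotone fun m => (st m).1 :=
    monotone_nat_of_le_succ fun m => (hN m _ _ (good m)).2.1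
  have mem : ∀ x, ∃ m, x ∈ (st m).1 := by
    intro x
    obtain ⟨m, rfl⟩ := ha x
    exact ⟨m + 1, (hN m _ _ (good m)).2.2.1⟩
  have stable : ∀ m k, m ≤ k → Set.EqOn (st k).2 (st m).2 (st m).1 := by
    intro m k hmk
    induction k, hmk using Nat.le_induction with
    | base => exact fun _ _ => rfl
    | succ k hmk ih =>
      intro x hx
      exact ((hN k _ _ (good k)).2.2.2.1 (mono hmk hx)).trans (ih hx)
  choose idx hidx using mem
  refine ⟨fun m => (st m).1, fun m => (st m).2, fun x => (st (idx x)).2 x, rfl, rfl, mono,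
    fun x => ⟨idx x, hidx x⟩, good, fun m x hx => ?_, fun m => (hN m _ _ (good m)).2.2.2.2⟩
  rcases le_total m (idx x) with h | h
  · exact (stable _ _ h hx).symm
  · exact stable _ _ h (hidx x)

/-! ## Embeddings along which all monotone maps extend -/

/-- Relative to `S`, the cut of `q` is determined by finitely many elements of `S`. -/
def FinitelyBased {P : Type} [PartialOrder P] (S : Set P) (q : P) : Prop :=
  (∃ A : Set P, A.Finite ∧ A ⊆ S ∧ (∀ a ∈ A, a ≤ q) ∧ ∀ s ∈ S, s ≤ q → ∃ a ∈ A, s ≤ a) ∧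
  ∃ B : Set P, B.Finite ∧ B ⊆ S ∧ (∀ b ∈ B, q ≤ b) ∧ ∀ s ∈ S, q ≤ s → ∃ b ∈ B, b ≤ s

theorem FinitelyBased.insert_point {P : Type} [PartialOrder P] {S : Set P} {q : P}
    (h : FinitelyBased S q) (p : P) : FinitelyBased (insert p S) q := by
  obtain ⟨⟨A, hA, hAS, hAq, hAc⟩, B, hB, hBS, hBq, hBc⟩ := h
  constructor
  · by_cases hp : p ≤ q
    · refine ⟨insert p A, hA.insert p, Set.insert_subset_insert hAS, ?_, ?_⟩
      · rintro a (rfl | ha)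
        · exact hp
        · exact hAq a ha
      · rintro s (rfl | hs) hsq
        · exact ⟨s, Or.inl rfl, le_rfl⟩
        · obtain ⟨a, ha, hsa⟩ := hAc s hs hsq
          exact ⟨a, Or.inr ha, hsa⟩
    · refine ⟨A, hA, hAS.trans (Set.subset_insert _ _), hAq, ?_⟩
      rintro s (rfl | hs) hsq
      · exact absurd hsq hp
      · exact hAc s hs hsq
  · by_cases hp : q ≤ p
    · refine ⟨insert p B, hB.insert p, Set.insert_subset_insert hBS, ?_, ?_⟩
      · rintro a (rfl | ha)
        · exact hp
        · exact hBq a ha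
      · rintro s (rfl | hs) hsq
        · exact ⟨s, Or.inl rfl, le_rfl⟩
        · obtain ⟨a, ha, hsa⟩ := hBc s hs hsq
          exact ⟨a, Or.inr ha, hsa⟩
    · refine ⟨B, hB, hBS.trans (Set.subset_insert _ _), hBq, ?_⟩
      rintro s (rfl | hs) hsq
      · exact absurd hsq hp
      · exact hBc s hs hsq

theorem OnePointExtension.exists_monotoneOn_insert {P : Type} [PartialOrder P]
    (hP : OnePointExtension P) {S : Set P} {q : P} (hS : FinitelyBased S q) {f : P → P}
    (hf : MonotoneOn f S) : ∃ f', MonotoneOn f' (insert q S) ∧ Set.EqOn f' f S := by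
  classical
  by_cases hq : q ∈ S
  · exact ⟨f, by rwa [Set.insert_eq_of_mem hq], fun _ _ => rfl⟩
  obtain ⟨⟨A, hA, hAS, hAq, hAc⟩, B, hB, hBS, hBq, hBc⟩ := hS
  obtain ⟨z, hAz, hzB⟩ := hP.exists_between (hA.image f) (hB.image f) (by
    rintro _ ⟨a, ha, rfl⟩ _ ⟨b, hb, rfl⟩
    exact hf (hAS ha) (hBS hb) ((hAq a ha).trans (hBq b hb)))
  have heq : Set.EqOn (Function.update f q z) f S := fun s hs =>
    Function.update_of_ne (fun e : s = q => hq (e ▸ hs)) _ _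
  refine ⟨Function.update f q z, ?_, heq⟩
  rintro a (rfl | ha) b (rfl | hb) hab
  · exact le_rfl
  · rw [Function.update_self, heq hb]
    obtain ⟨c, hc, hcb⟩ := hBc b hb hab
    exact (hzB _ ⟨c, hc, rfl⟩).trans (hf (hBS hc) hb hcb)
  · rw [Function.update_self, heq ha]
    obtain ⟨c, hc, hac⟩ := hAc a ha hab
    exact (hf ha (hAS hc) hac).trans (hAz _ ⟨c, hc, rfl⟩)
  · rw [heq ha, heq hb]
    exact hf ha hb hab

theorem OnePointExtension.exists_monotone_extension {P : Type} [PartialOrder P] [Countable P]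
    (hP : OnePointExtension P) {S : Set P} (hS : ∀ q, FinitelyBased S q) {f : P → P}
    (hf : MonotoneOn f S) : ∃ r : P → P, Monotone r ∧ Set.EqOn r f S := by
  rcases isEmpty_or_nonempty P with hE | hE
  · exact ⟨f, fun a => hE.elim a, fun _ _ => rfl⟩
  obtain ⟨a, ha⟩ := exists_surjective_nat P
  obtain ⟨T, F, r, hT, hF, hmono, hmem, hgood, heq, -⟩ := exists_limit_of_steps a ha
    (fun T f => (∀ q, FinitelyBased T q) ∧ MonotoneOn f T) (fun _ _ _ _ => True) S f ⟨hS, hf⟩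
    (by
      rintro m T g ⟨hT, hg⟩
      obtain ⟨g', hg', hgg'⟩ := hP.exists_monotoneOn_insert (hT (a m)) hg
      exact ⟨insert (a m) T, g', ⟨fun q => (hT q).insert_point _, hg'⟩, Set.subset_insert _ _,
        Set.mem_insert _ _, hgg', trivial⟩)
  refine ⟨r, fun x y hxy => ?_, fun x hx => ?_⟩
  · obtain ⟨m, hm⟩ := hmem x
    obtain ⟨k, hk⟩ := hmem y
    have hx := hmono (le_max_left m k) hm
    have hy := hmono (le_max_right m k) hk
    rw [← heq _ hx, ← heq _ hy]
    exact (hgood _).2 hx hy hxy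
  · rw [← hF]
    exact (heq 0 (hT ▸ hx)).symm

theorem OnePointExtension.exists_embedding_finitelyBased {P X : Type} [PartialOrder P]
    [Countable P] [Nonempty P] [PartialOrder X] [Countable X] (hP : OnePointExtension P) :
    ∃ i : X → P, (∀ x y, i x ≤ i y ↔ x ≤ y) ∧ ∀ q, FinitelyBased (Set.range i) q := by
  classical
  rcases isEmpty_or_nonempty X with hE | hE
  · refine ⟨fun x => hE.elim x, fun x => hE.elim x, fun q => ?_⟩
    exact ⟨⟨∅, Set.finite_empty, Set.empty_subset _, by simp, by simp⟩,
      ⟨∅, Set.finite_empty, Set.empty_subset _, by simp, by simp⟩⟩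
  obtain ⟨p, hp⟩ := exists_surjective_nat P
  obtain ⟨a, ha⟩ := exists_surjective_nat X
  obtain ⟨S, F, i, -, -, hmono, hmem, hgood, heq, hstep⟩ := exists_limit_of_steps a ha
    (fun S f => S.Finite ∧ ∀ x ∈ S, ∀ y ∈ S, f x ≤ f y ↔ x ≤ y)
    (fun m S S' f => ∀ k ≤ m, ∀ x ∈ S',
      (f x ≤ p k → ∃ l ∈ S, x ≤ l ∧ f l ≤ p k) ∧ (p k ≤ f x → ∃ l ∈ S, l ≤ x ∧ p k ≤ f l))
    ∅ (fun _ => Classical.arbitrary P) ⟨Set.finite_empty, by simp⟩ (by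
      rintro m S f ⟨hS, hf⟩
      by_cases hx : a m ∈ S
      · exact ⟨S, f, ⟨hS, hf⟩, subset_rfl, hx, fun _ _ => rfl, fun k _ x hx =>
          ⟨fun h => ⟨x, hx, le_rfl, h⟩, fun h => ⟨x, hx, le_rfl, h⟩⟩⟩
      obtain ⟨z, hz⟩ := hP (f '' S ∪ p '' Set.Iic m) {y | ∃ l ∈ S, l ≤ a m ∧ y ≤ f l}
        {y | ∃ l ∈ S, a m ≤ l ∧ f l ≤ y} ((hS.image f).union ((Set.finite_Iic m).image p))
        (fun b _ c _ hbc ⟨l, hl, hla, hcl⟩ => ⟨l, hl, hla, hbc.trans hcl⟩)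
        (fun b _ c _ hbc ⟨l, hl, hla, hcl⟩ => ⟨l, hl, hla, hcl.trans hbc⟩)
        (by
          rintro b - c - ⟨l, hl, hla, hbl⟩ ⟨l', hl', hal', hlc⟩
          have hll' := (hf l hl l' hl').2 (hla.trans hal')
          refine ((hbl.trans hll').trans hlc).lt_of_not_ge fun hcb => hx ?_
          have h1 : l' ≤ l := (hf l' hl' l hl).1 (hlc.trans (hcb.trans hbl))
          exact le_antisymm hla (hal'.trans h1) ▸ hl)
      have hfz : Set.EqOn (Function.update f (a m) z) f S := fun s hs =>
        Function.update_of_ne (fun e : s = a m => hx (e ▸ hs)) _ _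
      have hz₁ : ∀ s ∈ S, f s ≤ z ↔ s ≤ a m := fun s hs =>
        (hz (f s) (Or.inl ⟨s, hs, rfl⟩)).1.trans
          ⟨fun ⟨l, hl, hla, h⟩ => ((hf s hs l hl).1 h).trans hla, fun h => ⟨s, hs, h, le_rfl⟩⟩
      have hz₂ : ∀ s ∈ S, z ≤ f s ↔ a m ≤ s := fun s hs =>
        (hz (f s) (Or.inl ⟨s, hs, rfl⟩)).2.trans
          ⟨fun ⟨l, hl, hla, h⟩ => hla.trans ((hf l hl s hs).1 h), fun h => ⟨s, hs, h, le_rfl⟩⟩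
      refine ⟨insert (a m) S, Function.update f (a m) z, ⟨hS.insert _, ?_⟩,
        Set.subset_insert _ _, Set.mem_insert _ _, hfz, ?_⟩
      · rintro x (rfl | hxS) y (rfl | hyS)
        · simp
        · rw [Function.update_self, hfz hyS, hz₂ y hyS]
        · rw [Function.update_self, hfz hxS, hz₁ x hxS]
        · rw [hfz hxS, hfz hyS, hf x hxS y hyS]
      · rintro k hk x (rfl | hxS)
        · have hpk := hz (p k) (Or.inr ⟨k, hk, rfl⟩)
          rw [Function.update_self]
          constructor
          · intro h
            obtain ⟨l, hl, h1, h2⟩ := hpk.2.1 h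
            exact ⟨l, hl, h1, by rwa [hfz hl]⟩
          · intro h
            obtain ⟨l, hl, h1, h2⟩ := hpk.1.1 h
            exact ⟨l, hl, h1, by rwa [hfz hl]⟩
        · exact ⟨fun h => ⟨x, hxS, le_rfl, h⟩, fun h => ⟨x, hxS, le_rfl, h⟩⟩)
  have hstep' : ∀ k m, k ≤ m → ∀ x ∈ S m,
      (i x ≤ p k → ∃ l ∈ S k, x ≤ l ∧ i l ≤ p k) ∧
      (p k ≤ i x → ∃ l ∈ S k, l ≤ x ∧ p k ≤ i l) := by
    intro k m hkm
    induction m, hkm using Nat.le_induction with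
    | base => exact fun x hx => ⟨fun h => ⟨x, hx, le_rfl, h⟩, fun h => ⟨x, hx, le_rfl, h⟩⟩
    | succ m hkm ih =>
      intro x hx
      have hsub := hmono (Nat.le_succ m)
      constructor
      · intro h
        obtain ⟨l, hl, hxl, hlp⟩ := (hstep m k hkm x hx).1 (by rwa [heq _ hx])
        obtain ⟨l', hl', hll', h'⟩ := (ih l hl).1 (by rwa [← heq _ (hsub hl)])
        exact ⟨l', hl', hxl.trans hll', h'⟩
      · intro h
        obtain ⟨l, hl, hxl, hlp⟩ := (hstep m k hkm x hx).2 (by rwa [heq _ hx])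
        obtain ⟨l', hl', hll', h'⟩ := (ih l hl).2 (by rwa [← heq _ (hsub hl)])
        exact ⟨l', hl', hll'.trans hxl, h'⟩
  have hi : ∀ x y, i x ≤ i y ↔ x ≤ y := by
    intro x y
    obtain ⟨m, hm⟩ := hmem x
    obtain ⟨k, hk⟩ := hmem y
    have hx := hmono (le_max_left m k) hm
    have hy := hmono (le_max_right m k) hk
    rw [← heq _ hx, ← heq _ hy]
    exact (hgood _).2 x hx y hy
  have hbase : ∀ k x, (i x ≤ p k → ∃ l ∈ S k, x ≤ l ∧ i l ≤ p k) ∧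
      (p k ≤ i x → ∃ l ∈ S k, l ≤ x ∧ p k ≤ i l) := by
    intro k x
    obtain ⟨m, hm⟩ := hmem x
    exact hstep' k _ (le_max_left k m) x (hmono (le_max_right k m) hm)
  refine ⟨i, hi, fun q => ?_⟩
  obtain ⟨k, rfl⟩ := hp q
  constructor
  · refine ⟨i '' {l ∈ S k | i l ≤ p k}, ((hgood k).1.subset (Set.sep_subset _ _)).image i,
      Set.image_subset_range _ _, ?_, ?_⟩
    · rintro _ ⟨l, ⟨-, hl⟩, rfl⟩
      exact hl
    · rintro _ ⟨x, rfl⟩ hx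
      obtain ⟨l, hl, hxl, h⟩ := (hbase k x).1 hx
      exact ⟨i l, ⟨l, ⟨hl, h⟩, rfl⟩, (hi x l).2 hxl⟩
  · refine ⟨i '' {l ∈ S k | p k ≤ i l}, ((hgood k).1.subset (Set.sep_subset _ _)).image i,
      Set.image_subset_range _ _, ?_, ?_⟩
    · rintro _ ⟨l, ⟨-, hl⟩, rfl⟩
      exact hl
    · rintro _ ⟨x, rfl⟩ hx
      obtain ⟨l, hl, hxl, h⟩ := (hbase k x).2 hx
      exact ⟨i l, ⟨l, ⟨hl, h⟩, rfl⟩, (hi l x).2 hxl⟩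

/-- Every countable poset maps to `P` in such a way that all monotone maps to `P` extend. -/
theorem OnePointExtension.exists_extensible_embedding {P X : Type} [PartialOrder P] [Countable P]
    [Nonempty P] [PartialOrder X] [Countable X] (hP : OnePointExtension P) :
    ∃ i : X → P, Monotone i ∧
      ∀ φ : X → P, Monotone φ → ∃ r : P → P, Monotone r ∧ ∀ x, r (i x) = φ x := by
  obtain ⟨i, hi, hfin⟩ := hP.exists_embedding_finitelyBased (X := X)
  have hinj : Function.Injective i := fun x y h =>
    le_antisymm ((hi x y).1 h.le) ((hi y x).1 h.ge)
  refine ⟨i, fun x y h => (hi x y).2 h, fun φ hφ => ?_⟩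
  have hext : ∀ x, Function.extend i φ id (i x) = φ x := hinj.extend_apply φ id
  obtain ⟨r, hr, hrf⟩ := hP.exists_monotone_extension hfin (f := Function.extend i φ id) (by
    rintro _ ⟨x, rfl⟩ _ ⟨y, rfl⟩ hxy
    rw [hext, hext]
    exact hφ ((hi x y).1 hxy))
  exact ⟨r, hr, fun x => (hrf ⟨x, rfl⟩).trans (hext x)⟩

/-- For a convergent sequence `F` with limit `f` there are continuum many monotone maps, any two
of which can be sent simultaneously to `f` and to a member of the sequence. -/
theorem OnePointExtension.exists_separated_family {P Q : Type} [PartialOrder P] [Countable P]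
    [Nonempty P] [PartialOrder Q] [Countable Q] (hP : OnePointExtension P) (e : Q → ℕ)
    {f : Q → P} (hf : Monotone f) {F : ℕ → Q → P} (hF : ∀ k, Monotone (F k))
    (hFf : ∀ k q, e q < k → F k q = f q) :
    ∃ g : (ℕ → Bool) → Q → P, (∀ α, Monotone (g α)) ∧
      ∀ α β, α ≠ β → ∃ (k : ℕ) (r : P → P), Monotone r ∧
        (∀ q, r (g α q) = f q) ∧ ∀ q, r (g β q) = F k q := by
  classical
  let ψ : (ℕ → Bool) → Q → ((ℕ → Bool) × ℕ → P) :=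
    fun α q w => if ∀ i < w.2, α i = w.1 i then f q else F w.2 q
  have hψ : ∀ α, Monotone (ψ α) := by
    intro α p q hpq w
    by_cases h : ∀ i < w.2, α i = w.1 i
    · simp only [ψ, if_pos h]
      exact hf hpq
    · simp only [ψ, if_neg h]
      exact hF _ hpq
  have hloc : ∀ q α β, (∀ i < e q, α i = β i) → ψ α q = ψ β q := by
    intro q α β hαβ
    funext w
    by_cases hw : e q < w.2
    · simp [ψ, hFf _ _ hw]
    · have : (∀ i < w.2, α i = w.1 i) ↔ ∀ i < w.2, β i = w.1 i :=
        forall₂_congr fun i hi => by rw [hαβ i (by omega)]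
      simp [ψ, this]
  let X : Set ((ℕ → Bool) × ℕ → P) := ⋃ q, Set.range fun α => ψ α q
  have hX : X.Countable := by
    refine Set.countable_iUnion fun q => ?_
    refine (Set.countable_range fun s : Fin (e q) → Bool =>
      ψ (fun i => if h : i < e q then s ⟨i, h⟩ else false) q).mono ?_
    rintro _ ⟨α, rfl⟩
    refine ⟨fun i => α i, hloc q _ _ fun i hi => ?_⟩
    simp [hi]
  have : Countable X := hX
  obtain ⟨i, hi, hext⟩ := hP.exists_extensible_embedding (X := X)
  refine ⟨fun α q => i ⟨ψ α q, Set.mem_iUnion.2 ⟨q, α, rfl⟩⟩,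
    fun α p q hpq => hi (hψ α hpq), fun α β hαβ => ?_⟩
  obtain ⟨j, hj⟩ := Function.ne_iff.1 hαβ
  obtain ⟨r, hr, hrφ⟩ := hext (fun x => x.1 (α, j + 1)) fun x y hxy => hxy _
  refine ⟨j + 1, r, hr, fun q => ?_, fun q => ?_⟩
  · rw [hrφ]
    simp [ψ]
  · rw [hrφ]
    exact if_neg fun h => hj (h j j.lt_succ_self).symm

/-! ## Automatic continuity and openness -/

theorem CloneHom.app_comp_unary {U V : Type} {C : Clone U} {D : Clone V} (h : CloneHom C D)
    {n : ℕ} (r : C.ops 0) (g f : C.ops n) (hf : ∀ x, r.val (fun _ => g.val x) = f.val x)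
    (v : Fin (n + 1) → V) : (h.app n f).val v = (h.app 0 r).val fun _ => (h.app n g).val v := by
  have hc := h.map_comp 0 n r fun _ => g
  rw [← congrFun hc v]
  exact congrArg (fun g => (h.app n g).val v) (Subtype.ext (funext fun x => (hf x).symm))

theorem OnePointExtension.exists_finite_determining {P : Type} [PartialOrder P] [Countable P]
    [Nonempty P] (hP : OnePointExtension P) {V : Type} [Countable V] {D : Clone V}
    (h : CloneHom (polClone (ordStruc P)) D) {n : ℕ} (f : (polClone (ordStruc P)).ops n)
    (v : Fin (n + 1) → V) : ∃ E : Set (Fin (n + 1) → P), E.Finite ∧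
      ∀ f' : (polClone (ordStruc P)).ops n, Set.EqOn f'.val f.val E →
        (h.app n f').val v = (h.app n f).val v := by
  by_contra! hcon
  obtain ⟨e, he⟩ := exists_injective_nat (Fin (n + 1) → P)
  choose F hF hFv using fun k : ℕ =>
    hcon (e ⁻¹' Set.Iio k) ((Set.finite_Iio k).preimage he.injOn)
  obtain ⟨g, hg, hsep⟩ := hP.exists_separated_family e
    ((isPolymorphism_ordStruc_iff _).1 f.2) (F := fun k => (F k).val)
    (fun k => (isPolymorphism_ordStruc_iff _).1 (F k).2) (fun k q hq => hF k hq)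
  let g' : (ℕ → Bool) → (polClone (ordStruc P)).ops n :=
    fun α => ⟨g α, (isPolymorphism_ordStruc_iff _).2 (hg α)⟩
  have hninj : ¬ Function.Injective fun α => (h.app n (g' α)).val v := by
    intro hinj
    have := hinj.countable
    obtain ⟨s, hs⟩ := exists_surjective_nat (ℕ → Bool)
    obtain ⟨m, hm⟩ := hs fun i => !s i i
    simpa using congrFun hm m
  simp only [Function.Injective, not_forall] at hninj
  obtain ⟨α, β, hv, hne⟩ := hninj
  obtain ⟨k, r, hr, hrf, hrF⟩ := hsep α β hne
  let r' : (polClone (ordStruc P)).ops 0 :=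
    ⟨fun x => r (x 0), (isPolymorphism_ordStruc_iff _).2 fun x y hxy => hr (hxy 0)⟩
  refine hFv k ?_
  rw [h.app_comp_unary r' (g' α) f hrf v, h.app_comp_unary r' (g' β) (F k) hrF v, hv]

/-- The constant operations of the clone of monotone maps. -/
def constOp {P : Type} [PartialOrder P] (n : ℕ) (p : P) : (polClone (ordStruc P)).ops n :=
  ⟨fun _ => p, (isPolymorphism_ordStruc_iff (P := P) _).2 monotone_const⟩

theorem CloneHom.app_constOp_eq {P V : Type} [PartialOrder P] {D : Clone V}
    (h : CloneHom (polClone (ordStruc P)) D) (p : P) (x y : Fin 1 → V) :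
    (h.app 0 (constOp 0 p)).val x = (h.app 0 (constOp 0 p)).val y := by
  have key : ∀ i : Fin 2, (h.app 1 (constOp 1 p)).val ![x 0, y 0] =
      (h.app 0 (constOp 0 p)).val fun _ => ![x 0, y 0] i := by
    intro i
    have h1 := h.app_comp_unary (constOp 0 p)
      ⟨fun x => x i, (polClone (ordStruc P)).proj_mem 1 i⟩ (constOp 1 p) (fun _ => rfl)
      ![x 0, y 0]
    rwa [h.map_proj 1 i] at h1
  have h2 := (key 0).symm.trans (key 1)
  convert h2 using 2 <;> · funext j; fin_cases j; rfl

/-- An injective clone homomorphism from the clone of monotone maps embeds the underlying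
algebra. -/
theorem CloneHom.exists_embedding_of_injective {P V : Type} [PartialOrder P] [Nontrivial P]
    {D : Clone V} (h : CloneHom (polClone (ordStruc P)) D)
    (hinj : Function.Injective (h.app 0)) :
    ∃ θ : P → V, Function.Injective θ ∧
      ∀ (n : ℕ) (f : (polClone (ordStruc P)).ops n) (x : Fin (n + 1) → P),
        (h.app n f).val (fun i => θ (x i)) = θ (f.val x) := by
  have hV : Nonempty V := by
    by_contra hV
    rw [not_nonempty_iff] at hV
    obtain ⟨p, q, hpq⟩ := exists_pair_ne P
    refine hpq ?_
    have := hinj (a₁ := constOp 0 p) (a₂ := constOp 0 q)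
      (Subtype.ext (funext fun x => hV.elim (x 0)))
    exact congrFun (congrArg Subtype.val this) fun _ => p
  obtain ⟨v⟩ := hV
  refine ⟨fun p => (h.app 0 (constOp 0 p)).val fun _ => v, fun p q hpq => ?_, ?_⟩
  · have := hinj (a₁ := constOp 0 p) (a₂ := constOp 0 q) (Subtype.ext (funext fun x => by
      rw [h.app_constOp_eq p x fun _ => v, h.app_constOp_eq q x fun _ => v]
      exact hpq))
    exact congrFun (congrArg Subtype.val this) fun _ => p
  · intro n f x
    have hc := h.map_comp n 0 f fun i => constOp 0 (x i)
    exact (congrFun hc fun _ => v).symm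


/-- The polymorphism clone of the generic poset — i.e. of a countable
homogeneous poset (with reflexive order relation) into which every finite poset
embeds — has automatic homeomorphicity: every clone isomorphism from it to the
polymorphism clone of any countable relational structure is a homeomorphism. -/
theorem stmt_19 (P : Type) [PartialOrder P] (hc : Countable P)
    (hhom : RelStr.IsHomogeneous (ordStruc P))
    (hage : ∀ (Q : Type) [PartialOrder Q] [Finite Q],
      ∃ ι : Q → P, ∀ a b : Q, ι a ≤ ι b ↔ a ≤ b) :
    ∀ (τ : RelSig) (V : RelStr τ), Countable V.carrier →
      ∀ h : CloneHom (polClone (ordStruc P)) (polClone V),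
        (∀ n : ℕ, Function.Bijective (h.app n)) →
        @IsHomeomorph _ _ (cloneTop (polClone (ordStruc P))) (cloneTop (polClone V))
          h.elemMap := by
  intro τ V hV h hbij
  have hP := onePointExtension_of_homogeneous P hhom hage
  obtain ⟨ι, hι⟩ := hage Bool
  have : Nontrivial P :=
    ⟨ι false, ι true, fun e => absurd ((hι true false).1 e.ge) (by decide)⟩
  let tP : TopologicalSpace (ordStruc P).carrier := ⊥
  let tV : TopologicalSpace V.carrier := ⊥
  have : DiscreteTopology (ordStruc P).carrier := ⟨rfl⟩
  have : DiscreteTopology V.carrier := ⟨rfl⟩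
  change IsHomeomorph h.elemMap
  have hcont : ∀ n, Continuous (h.app n) := by
    intro n
    refine continuous_induced_rng.2 (continuous_pi fun v => ?_)
    refine ((IsLocallyConstant.iff_exists_open _).2 fun f => ?_).continuous
    obtain ⟨E, hE, hdet⟩ := hP.exists_finite_determining h f v
    refine ⟨⋂ x ∈ E, {f' | f'.val x = f.val x}, hE.isOpen_biInter fun x _ => ?_, ?_, ?_⟩
    · have hev : Continuous fun f' : (polClone (ordStruc P)).ops n => f'.val x :=
        (continuous_apply (A := fun _ => (ordStruc P).carrier) x).comp continuous_subtype_val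
      exact (isOpen_discrete ({f.val x} : Set (ordStruc P).carrier)).preimage hev
    · simp
    · intro f' hf'
      exact hdet f' fun x hx => Set.mem_iInter₂.1 hf' x hx
  have hopen : ∀ n, IsOpenMap (h.app n) := by
    intro n
    obtain ⟨θ, hθ, happ⟩ := h.exists_embedding_of_injective (hbij 0).1
    let eqv := Equiv.ofBijective _ (hbij n)
    have hinv : Continuous eqv.symm := by
      refine continuous_induced_rng.2 (continuous_pi fun x => ?_)
      refine (IsLocallyConstant.desc (α := (ordStruc P).carrier) _ θ ?_ hθ).continuous
      have heq : (θ ∘ fun f' => (eqv.symm f').val x) = fun f' => f'.val fun i => θ (x i) := by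
        funext f'
        have h1 := happ n (eqv.symm f') x
        rw [show h.app n (eqv.symm f') = f' from eqv.apply_symm_apply f'] at h1
        exact h1.symm
      refine (IsLocallyConstant.iff_continuous _).2 ?_
      exact heq ▸ (continuous_apply _).comp continuous_subtype_val
    exact (eqv.toHomeomorphOfContinuousOpen (hcont n) (fun U hU => by
      rw [Equiv.image_eq_preimage_symm]
      exact hU.preimage hinv)).isOpenMap
  refine ⟨continuous_sigma fun n => continuous_sigmaMk.comp (hcont n),
    isOpenMap_sigma.2 fun n => isOpenMap_sigmaMk.comp (hopen n), ?_, ?_⟩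
  · rintro ⟨n, f⟩ ⟨m, g⟩ hfg
    obtain rfl : n = m := congrArg Sigma.fst hfg
    exact congrArg _ ((hbij n).1 (sigma_mk_injective (β := fun n => (polClone V).ops n) hfg))
  · rintro ⟨n, f⟩
    obtain ⟨g, rfl⟩ := (hbij n).2 f
    exact ⟨⟨n, g⟩, rfl⟩
end
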